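/- Let b > 1/2. There exists a constant C > 0, depending only on b and C₀, such that the following holds for every N ≥ 1, every multiplier m as in the context, every 0 < δ ≤ 1, and all Schwartz functions u₁, …, u₆ on ℝ_t × ℝ_x: |∫₀^δ ∫_{ℝ⁵} σ₄(ξ₁, ξ₂, ξ₃, ξ₄+ξ₅+ξ₆) û₁(t,ξ₁) ŵ₂(t,ξ₂) û₃(t,ξ₃) ŵ₄(t,ξ₄) û₅(t,ξ₅) ŵ₆(t,ξ₆) dξ₁⋯dξ₅ dt| ≤ C N^{-3} ∏_{j=1}^{6} ‖Iu_j‖_{X^{0,b}}, where ξ₆ = −ξ₁−ξ₂−ξ₃−ξ₄−ξ₅, û_j(t,·) denotes the spatial Fourier transform of u_j(t,·), and ŵ_j(t,ξ) = conj(û_j(t,−ξ)) is the spatial Fourier transform of the complex conjugate of u_j(t,·). -/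

import Mathlib

open MeasureTheory Complex
open scoped ENNReal

/-- `m` is the `I`-method multiplier at level `N` (with `s = -1/2`), with derivative
bounds of constant `C₀`. -/
def IsIMultiplier (N C₀ : ℝ) (m : ℝ → ℝ) : Prop :=
  ContDiff ℝ (⊤ : ℕ∞) m ∧ (∀ ξ, m (-ξ) = m ξ) ∧ (∀ ξ, m ξ ∈ Set.Icc (0:ℝ) 1) ∧
  (∀ a b : ℝ, 0 ≤ a → a ≤ b → m b ≤ m a) ∧
  (∀ ξ : ℝ, |ξ| ≤ N → m ξ = 1) ∧
  (∀ ξ : ℝ, 2 * N ≤ |ξ| → m ξ = (|ξ| / N) ^ (-(1/2) : ℝ)) ∧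
  (∀ ξ : ℝ, ξ ≠ 0 → |deriv (fun x => (m x)^2) ξ| ≤ C₀ * (m ξ)^2 / |ξ|) ∧
  (∀ ξ : ℝ, ξ ≠ 0 → |deriv (deriv (fun x => (m x)^2)) ξ| ≤ C₀ * (m ξ)^2 / ξ^2)

/-- The correction-term multiplier `σ₄`. -/
noncomputable def sigma4 (m : ℝ → ℝ) (a b c d : ℝ) : ℝ :=
  if a^4 - b^4 + c^4 - d^4 = 0 then 0
  else ((m a)^2 - (m b)^2 + (m c)^2 - (m d)^2) / (a^4 - b^4 + c^4 - d^4)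

/-- The spatial Fourier transform `û(t,ξ) = ∫ e^{-ixξ} u(t,x) dx`. -/
noncomputable def fourierIntX (u : ℝ × ℝ → ℂ) (t ξ : ℝ) : ℂ :=
  ∫ x : ℝ, Complex.exp (-(Complex.I * x * ξ)) * u (t, x)

/-- The operator `I` acting in the spatial variable, `(Iu)^(t,ξ) = m(ξ) û(t,ξ)`,
realized in physical space. -/
noncomputable def IopST (m : ℝ → ℝ) (u : ℝ × ℝ → ℂ) (p : ℝ × ℝ) : ℂ :=
  (2 * Real.pi)⁻¹ * ∫ ξ : ℝ, Complex.exp (Complex.I * p.2 * ξ) * (m ξ : ℂ) * fourierIntX u p.1 ξ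

/-- The space-time Fourier transform `ũ(τ,ξ) = ∫∫ e^{-i(tτ+xξ)} u(t,x) dt dx`. -/
noncomputable def spaceTimeFT (u : ℝ × ℝ → ℂ) (τ ξ : ℝ) : ℂ :=
  ∫ p : ℝ × ℝ, Complex.exp (-(Complex.I * (p.1 * τ + p.2 * ξ))) * u p

/-- The Bourgain norm `‖u‖_{X^{s,b}} = ‖⟨ξ⟩^s ⟨τ+ξ⁴⟩^b ũ(τ,ξ)‖_{L²_{τ,ξ}}`. -/
noncomputable def Xnorm (s b : ℝ) (u : ℝ × ℝ → ℂ) : ℝ≥0∞ :=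
  eLpNorm (fun q : ℝ × ℝ =>
    (((1 + q.2^2) ^ (s/2) * (1 + (q.1 + q.2^4)^2) ^ (b/2) : ℝ) : ℂ) *
      spaceTimeFT u q.1 q.2) 2 volume

theorem abs_second_difference_le {f : ℝ → ℝ} (hf : ContDiff ℝ 2 f) {c x y L : ℝ}
    (hL : ∀ u, |u| ≤ |x| → |deriv f (c + y + u) - deriv f (c + u)| ≤ L) :
    |f (c + y + x) - f (c + y) + f c - f (c + x)| ≤ L * |x| := by
  have hd : Differentiable ℝ f := hf.differentiable (by norm_num)
  have hg : ∀ u, HasDerivAt (fun u => f (c + y + u) - f (c + u))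
      (deriv f (c + y + u) - deriv f (c + u)) u := fun u =>
    ((hd _).hasDerivAt.comp_const_add (c + y) u).sub ((hd _).hasDerivAt.comp_const_add c u)
  have h := (convex_Icc (-|x|) |x|).norm_image_sub_le_of_norm_hasDerivWithin_le
    (f := fun u => f (c + y + u) - f (c + u)) (x := 0) (y := x)
    (fun u _ => (hg u).hasDerivWithinAt) (fun u hu => hL u (abs_le.2 hu))
    ⟨by linarith [abs_nonneg x], abs_nonneg x⟩ (abs_le.1 le_rfl)
  simp only [Real.norm_eq_abs, add_zero, sub_zero] at h
  convert h using 2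
  ring

theorem abs_alternating_sum_le {f : ℝ → ℝ} (hf : ContDiff ℝ 2 f) {K N R : ℝ} (hK : 0 ≤ K)
    (hN : 0 < N) (hNR : N ≤ R) (h1 : ∀ x, |deriv f x| ≤ K / N)
    (h2 : ∀ x, x ≠ 0 → |deriv (deriv f) x| ≤ K / x ^ 2) {a b c d : ℝ} (hs : a + c = b + d)
    (hR : R ≤ |a| ∨ R ≤ |b| ∨ R ≤ |c| ∨ R ≤ |d|) :
    |f a - f b + f c - f d| ≤ 16 * K / (N * R) * (|a - b| * |a - d|) := by
  have hR0 : 0 < R := hN.trans_le hNR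
  obtain ⟨x, rfl⟩ : ∃ x, d = c + x := ⟨d - c, by ring⟩
  obtain ⟨y, rfl⟩ : ∃ y, b = c + y := ⟨b - c, by ring⟩
  obtain rfl : a = c + y + x := by linarith
  rw [show c + y + x - (c + y) = x by ring, show c + y + x - (c + x) = y by ring]
  have key : ∀ z w : ℝ, R / 8 ≤ |w| → 2 * K / N * |z| ≤ 16 * K / (N * R) * (|z| * |w|) := by
    intro z w hw
    have : 16 * K / (N * R) * (|z| * |w|) = 2 * K / N * |z| * (|w| / (R / 8)) := by
      field_simp; ring
    rw [this]
    exact le_mul_of_one_le_right (by positivity) ((one_le_div (by positivity)).2 hw)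
  have hdd : ∀ p q, |deriv f p - deriv f q| ≤ 2 * K / N := fun p q =>
    calc _ ≤ |deriv f p| + |deriv f q| := abs_sub _ _
      _ ≤ K / N + K / N := add_le_add (h1 _) (h1 _)
      _ = _ := by ring
  rcases le_or_gt (R / 8) |y| with hy | hy
  · exact (abs_second_difference_le hf (fun u _ => hdd _ _)).trans (key x y hy)
  rcases le_or_gt (R / 8) |x| with hx | hx
  · have := (abs_second_difference_le hf (c := c) (x := y) (y := x) (fun u _ => hdd _ _)).trans
      (key y x hx)
    have e : f (c + y + x) - f (c + y) + f c - f (c + x) =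
        f (c + x + y) - f (c + x) + f c - f (c + y) := by
      rw [add_right_comm]; ring
    rwa [mul_comm |x|, e]
  have hc : R * (3 / 4) ≤ |c| := by
    have t1 := abs_add_le (c + y) x
    have t2 := abs_add_le c y
    have t3 := abs_add_le c x
    rcases hR with h | h | h | h <;> linarith
  have hbig : ∀ v, |v| ≤ R / 4 → R / 2 ≤ |c + v| := by
    intro v hv
    have := abs_sub_abs_le_abs_sub c (-v)
    rw [abs_neg, sub_neg_eq_add] at this
    linarith
  have hd2 : ∀ u, |u| ≤ |x| → |deriv f (c + y + u) - deriv f (c + u)| ≤ 4 * K / R ^ 2 * |y| := by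
    intro u hu
    have hdiff : Differentiable ℝ (deriv f) :=
      hf.differentiable_deriv_two
    have h := (convex_Icc (-(R / 8)) (R / 8)).norm_image_sub_le_of_norm_hasDerivWithin_le
      (f := fun v => deriv f (c + u + v)) (x := 0) (y := y)
      (f' := fun v => deriv (deriv f) (c + u + v)) (C := 4 * K / R ^ 2)
      (fun v _ => ((hdiff _).hasDerivAt.comp_const_add (c + u) v).hasDerivWithinAt) ?_
      ⟨by linarith, by linarith⟩ (abs_le.1 hy.le)
    · simp only [Real.norm_eq_abs, add_zero, sub_zero] at h
      rwa [add_right_comm]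
    · intro v hv
      have hv' := abs_le.2 hv
      have hb := hbig (u + v) ((abs_add_le u v).trans (by linarith))
      rw [← add_assoc] at hb
      have h0 : c + u + v ≠ 0 := abs_pos.1 (by linarith)
      refine (h2 _ h0).trans ?_
      rw [← sq_abs (c + u + v)]
      calc K / |c + u + v| ^ 2 ≤ K / (R / 2) ^ 2 := by gcongr
        _ = _ := by field_simp; ring
  refine (abs_second_difference_le hf hd2).trans ?_
  calc 4 * K / R ^ 2 * |y| * |x| = 4 * K / (R * R) * (|x| * |y|) := by ring
    _ ≤ 16 * K / (N * R) * (|x| * |y|) := by (gcongr; linarith)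

namespace IsIMultiplier

variable {N C₀ : ℝ} {m : ℝ → ℝ}

theorem abs_deriv_sq_le (hm : IsIMultiplier N C₀ m) (hN : 0 < N) (hC : 0 ≤ C₀) (x : ℝ) :
    |deriv (fun x => m x ^ 2) x| ≤ C₀ / N := by
  obtain ⟨-, -, h01, -, hlow, -, hd, -⟩ := hm
  rcases lt_or_ge |x| N with hx | hx
  · have : (fun x => m x ^ 2) =ᶠ[nhds x] fun _ => (1 : ℝ) := by
      filter_upwards [(isOpen_lt continuous_abs continuous_const).mem_nhds hx] with z hz
      rw [hlow z (le_of_lt hz), one_pow]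
    rw [this.deriv_eq]
    simp only [deriv_const, abs_zero]
    positivity
  · have h0 : x ≠ 0 := abs_pos.1 (hN.trans_le hx)
    refine (hd x h0).trans ?_
    have h1 : m x ^ 2 ≤ 1 := pow_le_one₀ (h01 x).1 (h01 x).2
    calc C₀ * m x ^ 2 / |x| ≤ C₀ * 1 / N := by gcongr
      _ = _ := by ring

theorem abs_sigma4_le (hm : IsIMultiplier N C₀ m) (hN : 0 < N) (hC : 0 ≤ C₀) {R a b c d : ℝ}
    (hNR : N ≤ R) (hs : a + b + c + d = 0) (hR : R ≤ |a| ∨ R ≤ |b| ∨ R ≤ |c| ∨ R ≤ |d|) :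
    |sigma4 m a b c d| ≤ 16 * C₀ / (N * R ^ 3) := by
  have hR0 : 0 < R := hN.trans_le hNR
  unfold sigma4
  split_ifs with h0
  · rw [abs_zero]; positivity
  have hfac : a ^ 4 - b ^ 4 + c ^ 4 - d ^ 4 = (a + b) * (a + d) *
      (2 * (a + c) ^ 2 + (a ^ 2 + b ^ 2 + c ^ 2 + d ^ 2)) := by
    obtain rfl : d = -a - b - c := by linarith
    ring
  have hsq : R ^ 2 ≤ a ^ 2 + b ^ 2 + c ^ 2 + d ^ 2 := by
    have hh : ∀ z, R ≤ |z| → R ^ 2 ≤ z ^ 2 := fun z hz => by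
      rw [← sq_abs z]; gcongr
    rcases hR with h | h | h | h <;> nlinarith [hh _ h, sq_nonneg a, sq_nonneg b, sq_nonneg c,
      sq_nonneg d]
  have hnum := abs_alternating_sum_le (f := fun x => m x ^ 2) (contDiff_infty.1 (hm.1.pow 2) 2)
    hC hN hNR (hm.abs_deriv_sq_le hN hC) (fun x hx => (hm.2.2.2.2.2.2.2 x hx).trans (by
      have h1 : m x ^ 2 ≤ 1 := pow_le_one₀ (hm.2.2.1 x).1 (hm.2.2.1 x).2
      gcongr
      exact mul_le_of_le_one_right hC h1)) (a := a) (b := -b) (c := c) (d := -d) (by linarith)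
    (by simpa only [abs_neg] using hR)
  simp only [hm.2.1, sub_neg_eq_add] at hnum
  have hab : 0 < |a + b| * |a + d| := by
    rw [← abs_mul]
    exact abs_pos.2 fun h => h0 (by rw [hfac, h, zero_mul])
  rw [abs_div, hfac, abs_mul, abs_mul, abs_of_nonneg (a := 2 * _ + _) (by positivity),
    div_le_iff₀ (by nlinarith [sq_nonneg (a + c), pow_pos hR0 2])]
  refine hnum.trans ?_
  calc 16 * C₀ / (N * R) * (|a + b| * |a + d|)
      = 16 * C₀ / (N * R ^ 3) * (|a + b| * |a + d| * R ^ 2) := by field_simp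
    _ ≤ _ := by gcongr; nlinarith [sq_nonneg (a + c)]

theorem sigma4_eq_zero (hm : IsIMultiplier N C₀ m) {a b c d : ℝ}
    (ha : |a| ≤ N) (hb : |b| ≤ N) (hc : |c| ≤ N) (hd : |d| ≤ N) : sigma4 m a b c d = 0 := by
  simp [sigma4, hm.2.2.2.2.1 _ ha, hm.2.2.2.2.1 _ hb, hm.2.2.2.2.1 _ hc, hm.2.2.2.2.1 _ hd]

theorem max_le_two_mul_sq (hm : IsIMultiplier N C₀ m) (hN : 0 < N) (ξ : ℝ) :
    1 ≤ 2 * max 1 (|ξ| / N) * m ξ ^ 2 := by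
  obtain ⟨-, heven, h01, hmono, -, hhigh, -⟩ := hm
  have hsq : ∀ z : ℝ, 2 * N ≤ |z| → m z ^ 2 = (|z| / N)⁻¹ := by
    intro z hz
    rw [hhigh z hz, ← Real.rpow_natCast, ← Real.rpow_mul (by positivity), ← Real.rpow_neg_one]
    norm_num
  rcases le_or_gt (2 * N) |ξ| with h | h
  · rw [hsq ξ h]
    have : 0 < |ξ| := by linarith
    have h2 : 1 ≤ max 1 (|ξ| / N) * (|ξ| / N)⁻¹ := by
      rw [← div_eq_mul_inv, one_le_div (by positivity)]
      exact le_max_right _ _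
    linarith
  · have e : m ξ = m |ξ| := by
      rcases abs_choice ξ with h | h <;> rw [h]
      rw [heven]
    have h2 := hmono |ξ| (2 * N) (abs_nonneg _) h.le
    have h3 := hsq (2 * N) (le_abs_self _)
    rw [abs_of_pos (by positivity), mul_div_assoc, div_self hN.ne'] at h3
    have h4 : m (2 * N) ^ 2 ≤ m ξ ^ 2 := by
      rw [e]; exact pow_le_pow_left₀ (h01 _).1 h2 2
    have h5 : (1 : ℝ) ≤ max 1 (|ξ| / N) := le_max_left _ _
    nlinarith

/-- The symbol bound: the low-frequency factors `m(ξ₁), m(ξ₂), m(ξ₃)` are absorbed by the decay of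
`σ₄`, leaving a loss in the three remaining frequencies only. -/
theorem sq_sigma4_le (hm : IsIMultiplier N C₀ m) (hN : 1 ≤ N) (hC : 0 ≤ C₀)
    (x₁ x₂ x₃ x₄ x₅ x₆ : ℝ) :
    sigma4 m x₁ x₂ x₃ (-x₁ - x₂ - x₃) ^ 2 ≤
      (128 * C₀ * N ^ (-(3 : ℝ))) ^ 2 * ((1 + |x₅|) * ((1 + |x₄|) * (1 + |x₆|))) *
        (m x₁ * m x₂ * m x₃ * m x₄ * m x₅ * m x₆) ^ 2 := by
  have hN0 : 0 < N := by linarith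
  set d := -x₁ - x₂ - x₃ with hd
  set R := max (max |x₁| |x₂|) (max |x₃| |d|) with hRdef
  rcases le_or_gt R N with hle | hlt
  · have : sigma4 m x₁ x₂ x₃ d = 0 := by
      simp only [hRdef, max_le_iff] at hle
      exact hm.sigma4_eq_zero hle.1.1 hle.1.2 hle.2.1 hle.2.2
    rw [this, zero_pow two_ne_zero]; positivity
  have hR0 : 0 < R := hN0.trans hlt
  have hσ := hm.abs_sigma4_le hN0 hC (a := x₁) (b := x₂) (c := x₃) (d := d) hlt.le (by ring) (by
    simpa only [hRdef, le_max_iff, or_assoc] using (le_refl R))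
  have hsmall : ∀ x, |x| ≤ R → 1 ≤ 2 * (R / N) * m x ^ 2 := by
    intro x hx
    refine (hm.max_le_two_mul_sq hN0 x).trans ?_
    gcongr
    exact max_le ((one_le_div hN0).2 hlt.le) (by gcongr)
  have hany : ∀ x, 1 ≤ 2 * (1 + |x|) * m x ^ 2 := by
    intro x
    refine (hm.max_le_two_mul_sq hN0 x).trans ?_
    gcongr
    refine max_le (by linarith [abs_nonneg x]) ?_
    have : |x| / N ≤ |x| := div_le_self (abs_nonneg _) hN
    linarith
  have h1 := hsmall x₁ (by simp [hRdef])
  have h2 := hsmall x₂ (by simp [hRdef])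
  have h3 := hsmall x₃ (by simp [hRdef])
  have hprod : (1 : ℝ) ≤ (2 * (R / N) * m x₁ ^ 2) * (2 * (R / N) * m x₂ ^ 2) *
      (2 * (R / N) * m x₃ ^ 2) * (2 * (1 + |x₄|) * m x₄ ^ 2) * (2 * (1 + |x₅|) * m x₅ ^ 2) *
      (2 * (1 + |x₆|) * m x₆ ^ 2) := by
    have aux : ∀ {p q : ℝ}, 1 ≤ p → 1 ≤ q → 1 ≤ p * q := one_le_mul_of_one_le_of_one_le
    exact aux (aux (aux (aux (aux h1 h2) h3) (hany x₄)) (hany x₅)) (hany x₆)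
  have hNpow : N ^ (-(3 : ℝ)) = (N ^ 3)⁻¹ := by
    rw [Real.rpow_neg hN0.le]; norm_cast
  rw [hNpow]
  have hσ2 : sigma4 m x₁ x₂ x₃ d ^ 2 ≤ (16 * C₀ / (N * R ^ 3)) ^ 2 := by
    rw [← sq_abs]; gcongr
  refine (hσ2.trans (le_mul_of_one_le_right (by positivity) hprod)).trans ?_
  have hfin : (16 * C₀ / (N * R ^ 3)) ^ 2 * ((2 * (R / N) * m x₁ ^ 2) * (2 * (R / N) * m x₂ ^ 2) *
      (2 * (R / N) * m x₃ ^ 2) * (2 * (1 + |x₄|) * m x₄ ^ 2) * (2 * (1 + |x₅|) * m x₅ ^ 2) *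
      (2 * (1 + |x₆|) * m x₆ ^ 2)) = (128 * C₀) ^ 2 * (N ^ 5 * R ^ 3)⁻¹ *
        ((1 + |x₅|) * ((1 + |x₄|) * (1 + |x₆|))) *
        (m x₁ * m x₂ * m x₃ * m x₄ * m x₅ * m x₆) ^ 2 := by
    field_simp; ring
  rw [hfin]
  rw [mul_pow (128 * C₀)]
  have hpow : (N ^ 5 * R ^ 3)⁻¹ ≤ (N ^ 3)⁻¹ ^ 2 := by
    rw [inv_pow, ← pow_mul]
    refine inv_anti₀ (by positivity) ?_
    calc N ^ (3 * 2) = N ^ 5 * N := by ring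
      _ ≤ N ^ 5 * R ^ 3 := by
        gcongr
        calc N ≤ R := hlt.le
          _ ≤ R ^ 3 := le_self_pow₀ (hN.trans hlt.le) (by norm_num)
  gcongr

end IsIMultiplier

/-- The weight `(1 + |x|)^{-p}` as an extended nonnegative real. -/
noncomputable def decay (p x : ℝ) : ℝ≥0∞ := ENNReal.ofReal ((1 + |x|) ^ (-p))

theorem measurable_decay (p : ℝ) : Measurable (decay p) :=
  ((measurable_const.add continuous_abs.measurable).pow_const _).ennreal_ofReal

theorem decay_neg (p x : ℝ) : decay p (-x) = decay p x := by
  rw [decay, decay, abs_neg]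

theorem decay_le_one {p : ℝ} (hp : 0 ≤ p) (x : ℝ) : decay p x ≤ 1 := by
  rw [decay, ENNReal.ofReal_le_one]
  exact Real.rpow_le_one_of_one_le_of_nonpos (by linarith [abs_nonneg x]) (by linarith)

theorem decay_mul (p q x : ℝ) : decay p x * decay q x = decay (p + q) x := by
  have : 0 < 1 + |x| := by positivity
  rw [decay, decay, decay, ← ENNReal.ofReal_mul (by positivity), ← Real.rpow_add this,
    neg_add]

theorem decay_anti {p x y : ℝ} (hp : 0 ≤ p) (h : |x| ≤ |y|) : decay p y ≤ decay p x :=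
  ENNReal.ofReal_le_ofReal (Real.rpow_le_rpow_of_nonpos (by positivity) (by linarith)
    (by linarith))

theorem decay_mul_le_add {p q : ℝ} (hp : 0 ≤ p) (hq : 0 ≤ q) (x y : ℝ) :
    decay p x * decay q y ≤ decay (p + q) x + decay (p + q) y := by
  rcases le_total |x| |y| with h | h
  · calc decay p x * decay q y ≤ decay p x * decay q x := by gcongr; exact decay_anti hq h
      _ = decay (p + q) x := decay_mul ..
      _ ≤ _ := le_self_add
  · calc decay p x * decay q y ≤ decay p y * decay q y := by gcongr; exact decay_anti hp h
      _ = decay (p + q) y := decay_mul ..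
      _ ≤ _ := le_add_self

theorem lintegral_decay_lt_top {p : ℝ} (hp : 1 < p) : ∫⁻ x, decay p x < ∞ := by
  have h := (integrable_one_add_norm (E := ℝ) (μ := volume) (r := p) (by simpa using hp)).lintegral_lt_top
  simpa only [Real.norm_eq_abs, decay] using h

theorem lintegral_decay_sub_left (p c : ℝ) : ∫⁻ x, decay p (c - x) = ∫⁻ x, decay p x :=
  lintegral_sub_left_eq_self _ c

theorem lintegral_decay_sub_right (p c : ℝ) : ∫⁻ x, decay p (x - c) = ∫⁻ x, decay p x :=
  lintegral_sub_right_eq_self _ c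

theorem lintegral_deriv_mul_comp_le {Q Q' : ℝ → ℝ} (hQ : ∀ r, HasDerivAt Q (Q' r) r)
    (hpos : ∀ r, 0 < r → 0 < Q' r) (g : ℝ → ℝ≥0∞) :
    ∫⁻ r in Set.Ioi 0, ENNReal.ofReal (Q' r) * g (Q r) ≤ ∫⁻ x, g x := by
  have hinj : Set.InjOn Q (Set.Ioi 0) := by
    refine (strictMonoOn_of_deriv_pos (convex_Ioi 0)
      (fun x _ => (hQ x).continuousAt.continuousWithinAt) fun x hx => ?_).injOn
    rw [interior_Ioi] at hx
    rw [(hQ x).deriv]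
    exact hpos x hx
  calc _ = ∫⁻ r in Set.Ioi 0, ENNReal.ofReal |Q' r| * g (Q r) :=
        setLIntegral_congr_fun measurableSet_Ioi fun r hr => by
          simp only [abs_of_pos (hpos r hr)]
    _ = ∫⁻ x in Q '' Set.Ioi 0, g x :=
        (lintegral_image_eq_lintegral_abs_deriv_mul measurableSet_Ioi
          (fun x _ => (hQ x).hasDerivWithinAt) hinj g).symm
    _ ≤ _ := setLIntegral_le_lintegral _ _

theorem lintegral_plane_le_of_radial_le {f : ℝ × ℝ → ℝ≥0∞} (hf : Measurable f) (x y : ℝ)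
    {C : ℝ≥0∞} (h : ∀ a b : ℝ, a ^ 2 + b ^ 2 = 1 →
      ∫⁻ r in Set.Ioi 0, ENNReal.ofReal r * f (x + r * a, y + r * b) ≤ C) :
    ∫⁻ p, f p ≤ ENNReal.ofReal (2 * Real.pi) * C := by
  have h1 : ∫⁻ p, f p = ∫⁻ p : ℝ × ℝ, f ((x, y) + p) := (lintegral_add_left_eq_self f (x, y)).symm
  rw [h1, ← lintegral_comp_polarCoord_symm, polarCoord_target, Measure.volume_eq_prod,
    ← Measure.prod_restrict, lintegral_prod_symm]
  · calc _ ≤ ∫⁻ θ in Set.Ioo (-Real.pi) Real.pi, C := by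
          refine lintegral_mono fun θ => ?_
          simpa [polarCoord_symm_apply] using h (Real.cos θ) (Real.sin θ) (Real.cos_sq_add_sin_sq θ)
      _ = _ := by
        rw [setLIntegral_const, Real.volume_Ioo, mul_comm]
        ring_nf
  · have hm : Measurable fun p : ℝ × ℝ => polarCoord.symm p := by
      simp only [polarCoord_symm_apply]; fun_prop
    exact (measurable_fst.ennreal_ofReal.mul
      (hf.comp (measurable_const.add hm))).aemeasurable

section quartic

variable {s a b r : ℝ}

theorem quartic_hasDerivAt (s a b r : ℝ) :
    HasDerivAt (fun r => (s / 3 + r * a) ^ 4 + (s / 3 + r * b) ^ 4 +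
      (s - (s / 3 + r * a) - (s / 3 + r * b)) ^ 4)
    (4 * r * (s ^ 2 / 3 * (2 * (a ^ 2 + a * b + b ^ 2)) - s * r * (3 * (a * b * (a + b))) +
      r ^ 2 * (2 * (a ^ 2 + a * b + b ^ 2) ^ 2))) r := by
  have h1 : ∀ a, HasDerivAt (fun r : ℝ => s / 3 + r * a) a r := fun a => by
    simpa using ((hasDerivAt_id r).mul_const a).const_add (s / 3)
  have h := ((h1 a).pow 4).add ((h1 b).pow 4) |>.add ((((h1 a).const_sub s).sub (h1 b)).pow 4)
  refine h.congr_deriv ?_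
  simp only [Nat.cast_ofNat, Nat.add_one_sub_one, Pi.sub_apply]
  ring

theorem half_le_of_unit (hab : a ^ 2 + b ^ 2 = 1) : 1 / 2 ≤ a ^ 2 + a * b + b ^ 2 := by
  nlinarith [sq_nonneg (a + b)]

theorem le_three_halves_of_unit (hab : a ^ 2 + b ^ 2 = 1) : a ^ 2 + a * b + b ^ 2 ≤ 3 / 2 := by
  nlinarith [sq_nonneg (a - b)]

theorem sq_prod_le : 27 * (a * b * (a + b)) ^ 2 ≤ 4 * (a ^ 2 + a * b + b ^ 2) ^ 3 := by
  nlinarith [sq_nonneg ((a - b) * (2 * a + b) * (a + 2 * b))]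

theorem le_quartic_deriv (hab : a ^ 2 + b ^ 2 = 1) (hr : 0 ≤ r) :
    2 / 3 * (r * (s ^ 2 + r ^ 2)) ≤
    4 * r * (s ^ 2 / 3 * (2 * (a ^ 2 + a * b + b ^ 2)) - s * r * (3 * (a * b * (a + b))) +
      r ^ 2 * (2 * (a ^ 2 + a * b + b ^ 2) ^ 2)) := by
  have h1 := half_le_of_unit hab
  have h3 := sq_prod_le (a := a) (b := b)
  set P := a ^ 2 + a * b + b ^ 2
  set T := a * b * (a + b)
  have hT : 9 * T ^ 2 ≤ 4 / 3 * P ^ 3 := by linarith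
  have key : |s * r * (3 * T)| ≤ s ^ 2 / 3 * P + r ^ 2 * P ^ 2 := by
    refine abs_le_of_sq_le_sq ?_ (by positivity)
    calc (s * r * (3 * T)) ^ 2 = (s * r) ^ 2 * (9 * T ^ 2) := by ring
      _ ≤ (s * r) ^ 2 * (4 / 3 * P ^ 3) := by gcongr
      _ ≤ _ := by nlinarith [sq_nonneg (s ^ 2 / 3 * P - r ^ 2 * P ^ 2)]
  have hk := (le_abs_self _).trans key
  have hP2 : 1 / 4 ≤ P ^ 2 := by nlinarith
  have : (s ^ 2 + r ^ 2) / 6 ≤ s ^ 2 / 3 * (2 * P) - s * r * (3 * T) + r ^ 2 * (2 * P ^ 2) := by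
    nlinarith [mul_le_mul_of_nonneg_left h1 (sq_nonneg s),
      mul_le_mul_of_nonneg_left hP2 (sq_nonneg r)]
  nlinarith [mul_le_mul_of_nonneg_left this hr]

theorem abs_quartic_sub_le (hab : a ^ 2 + b ^ 2 = 1) :
    |(s / 3 + r * a) ^ 4 + (s / 3 + r * b) ^ 4 +
      (s - (s / 3 + r * a) - (s / 3 + r * b)) ^ 4 - s ^ 4 / 27| ≤ 10 * (s ^ 2 + r ^ 2) ^ 2 := by
  have h1 := half_le_of_unit hab
  have h2 := le_three_halves_of_unit hab
  have h3 := sq_prod_le (a := a) (b := b)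
  have e : (s / 3 + r * a) ^ 4 + (s / 3 + r * b) ^ 4 +
      (s - (s / 3 + r * a) - (s / 3 + r * b)) ^ 4 - s ^ 4 / 27 =
      4 / 3 * s ^ 2 * r ^ 2 * (a ^ 2 + a * b + b ^ 2) - 4 * (s * r ^ 3) * (a * b * (a + b)) +
        2 * r ^ 4 * (a ^ 2 + a * b + b ^ 2) ^ 2 := by ring
  rw [e]
  set P := a ^ 2 + a * b + b ^ 2
  set T := a * b * (a + b)
  have hP2 : P ^ 2 ≤ 9 / 4 := by nlinarith
  have hP3 : P ^ 3 ≤ 27 / 8 := by nlinarith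
  have hT : |T| ≤ 1 := abs_le_of_sq_le_sq (by nlinarith) (by norm_num)
  have hsr : |s * r ^ 3| ≤ (s ^ 2 * r ^ 2 + r ^ 4) / 2 := by
    rw [abs_le]
    constructor
    · nlinarith [sq_nonneg (s * r + r ^ 2)]
    · nlinarith [sq_nonneg (s * r - r ^ 2)]
  have hsrT : |s * r ^ 3 * T| ≤ (s ^ 2 * r ^ 2 + r ^ 4) / 2 := by
    rw [abs_mul]
    exact (mul_le_of_le_one_right (abs_nonneg _) hT).trans hsr
  have g1 := mul_le_mul_of_nonneg_left h2 (a := s ^ 2 * r ^ 2) (by positivity)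
  have g2 := mul_le_mul_of_nonneg_left hP2 (a := r ^ 4) (by positivity)
  have g3 : 0 ≤ s ^ 2 * r ^ 2 * P := by positivity
  have g4 : 0 ≤ r ^ 4 * P ^ 2 := by positivity
  have g5 : 0 ≤ s ^ 4 := by positivity
  have g6 : 0 ≤ r ^ 4 := by positivity
  have g7 : 0 ≤ s ^ 2 * r ^ 2 := by positivity
  rw [abs_le] at hsrT ⊢
  constructor <;> nlinarith [hsrT.1, hsrT.2]

theorem abs_le_one_of_unit (hab : a ^ 2 + b ^ 2 = 1) : |a| ≤ 1 ∧ |b| ≤ 1 := by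
  constructor <;> exact abs_le_of_sq_le_sq (by nlinarith [sq_nonneg a, sq_nonneg b]) zero_le_one

theorem abs_ray_le (hab : a ^ 2 + b ^ 2 = 1) (hr : 0 ≤ r) :
    |s / 3 + r * b| ≤ |s| + 2 * r ∧ |s - (s / 3 + r * a) - (s / 3 + r * b)| ≤ |s| + 2 * r := by
  obtain ⟨ha, hb⟩ := abs_le_one_of_unit hab
  have h1 := mul_le_mul_of_nonneg_left ha hr
  have h2 := mul_le_mul_of_nonneg_left hb hr
  have e : ∀ z : ℝ, r * |z| = |r * z| := fun z => by rw [abs_mul, abs_of_nonneg hr]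
  rw [e] at h1 h2
  have h3 := le_abs_self s
  have h4 := neg_abs_le s
  rw [abs_le] at h1 h2
  constructor <;> rw [abs_le] <;> constructor <;> linarith [abs_nonneg s]

end quartic

section radial

variable {s a b : ℝ}

theorem quartic_deriv_pos (hab : a ^ 2 + b ^ 2 = 1) {r : ℝ} (hr : 0 < r) :
    0 < 4 * r * (s ^ 2 / 3 * (2 * (a ^ 2 + a * b + b ^ 2)) - s * r * (3 * (a * b * (a + b))) +
      r ^ 2 * (2 * (a ^ 2 + a * b + b ^ 2) ^ 2)) :=
  lt_of_lt_of_le (by positivity) (le_quartic_deriv hab hr.le)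

theorem lintegral_indicator_Ioc_le (C : ℝ≥0∞) :
    ∫⁻ r in Set.Ioi (0 : ℝ), (Set.Ioc (0 : ℝ) 1).indicator (fun _ => C) r ≤ C := by
  refine (setLIntegral_le_lintegral _ _).trans ?_
  rw [lintegral_indicator measurableSet_Ioc, setLIntegral_const, Real.volume_Ioc]
  simp

theorem radial_product_le (hab : a ^ 2 + b ^ 2 = 1) (c : ℝ) :
    ∫⁻ r in Set.Ioi 0, ENNReal.ofReal r *
      (ENNReal.ofReal ((1 + |s / 3 + r * b|) * (1 + |s - (s / 3 + r * a) - (s / 3 + r * b)|)) *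
        decay (9 / 8) (c - ((s / 3 + r * a) ^ 4 + (s / 3 + r * b) ^ 4 +
          (s - (s / 3 + r * a) - (s / 3 + r * b)) ^ 4))) ≤
      12 + 36 * ∫⁻ x, decay (9 / 8) x := by
  set Q := fun r : ℝ => (s / 3 + r * a) ^ 4 + (s / 3 + r * b) ^ 4 +
          (s - (s / 3 + r * a) - (s / 3 + r * b)) ^ 4 with hQ
  set Q' := fun r : ℝ => 4 * r * (s ^ 2 / 3 * (2 * (a ^ 2 + a * b + b ^ 2)) -
    s * r * (3 * (a * b * (a + b))) + r ^ 2 * (2 * (a ^ 2 + a * b + b ^ 2) ^ 2)) with hQ'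
  have hpt : ∀ r ∈ Set.Ioi (0 : ℝ), ENNReal.ofReal r * (ENNReal.ofReal ((1 + |s / 3 + r * b|) *
      (1 + |s - (s / 3 + r * a) - (s / 3 + r * b)|)) * decay (9 / 8) (c - Q r)) ≤
      (Set.Ioc (0 : ℝ) 1).indicator (fun _ => 12) r +
        36 * (ENNReal.ofReal (Q' r) * decay (9 / 8) (c - Q r)) := by
    intro r hr
    have hr0 : (0 : ℝ) < r := hr
    have hd : 2 / 3 * (r * (s ^ 2 + r ^ 2)) ≤ Q' r := le_quartic_deriv hab hr0.le
    have hpos : 0 < Q' r := quartic_deriv_pos hab hr0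
    obtain ⟨hb, ha⟩ := abs_ray_le (s := s) hab hr0.le
    have hw : r * ((1 + |s / 3 + r * b|) * (1 + |s - (s / 3 + r * a) - (s / 3 + r * b)|)) ≤
        12 * r + 18 * Q' r := by
      calc _ ≤ r * ((1 + (|s| + 2 * r)) * (1 + (|s| + 2 * r))) := by gcongr
        _ ≤ r * (12 * (1 + (s ^ 2 + r ^ 2))) := by
          refine mul_le_mul_of_nonneg_left ?_ hr0.le
          nlinarith [sq_abs s, sq_nonneg (|s| - 1), sq_nonneg (2 * r - 1),
            sq_nonneg (|s| - 2 * r)]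
        _ ≤ _ := by linarith
    rcases le_or_gt r 1 with h1 | h1
    · rw [Set.indicator_of_mem (show r ∈ Set.Ioc (0 : ℝ) 1 from ⟨hr0, h1⟩), ← mul_assoc,
        ← ENNReal.ofReal_mul hr0.le]
      calc _ ≤ ENNReal.ofReal (12 + 36 * Q' r) * decay (9 / 8) (c - Q r) := by
            gcongr
            linarith
        _ = 12 * decay (9 / 8) (c - Q r) +
            36 * (ENNReal.ofReal (Q' r) * decay (9 / 8) (c - Q r)) := by
          rw [ENNReal.ofReal_add (by norm_num) (mul_nonneg (by norm_num) hpos.le),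
            ENNReal.ofReal_mul (by norm_num), add_mul, mul_assoc]
          simp only [ENNReal.ofReal_ofNat]
        _ ≤ _ := by
          gcongr
          exact mul_le_of_le_one_right' (decay_le_one (by norm_num) _)
    · rw [← mul_assoc, ← ENNReal.ofReal_mul hr0.le]
      refine le_trans ?_ le_add_self
      rw [← mul_assoc 36, show (36 : ℝ≥0∞) = ENNReal.ofReal 36 by simp,
        ← ENNReal.ofReal_mul (by norm_num)]
      gcongr ENNReal.ofReal ?_ * _
      have : r ≤ r * (s ^ 2 + r ^ 2) := le_mul_of_one_le_right hr0.le (by nlinarith [sq_nonneg s])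
      linarith
  calc _ ≤ ∫⁻ r in Set.Ioi 0, ((Set.Ioc (0 : ℝ) 1).indicator (fun _ => 12) r +
        36 * (ENNReal.ofReal (Q' r) * decay (9 / 8) (c - Q r))) :=
        setLIntegral_mono' measurableSet_Ioi hpt
    _ = (∫⁻ r in Set.Ioi 0, (Set.Ioc (0 : ℝ) 1).indicator (fun _ => (12 : ℝ≥0∞)) r) +
        36 * ∫⁻ r in Set.Ioi 0, ENNReal.ofReal (Q' r) * decay (9 / 8) (c - Q r) := by
      rw [lintegral_add_left (measurable_const.indicator measurableSet_Ioc),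
        lintegral_const_mul' _ _ (by norm_num)]
    _ ≤ _ := by
      rw [← lintegral_decay_sub_left (9 / 8) c]
      exact add_le_add (lintegral_indicator_Ioc_le _) (mul_le_mul_right
        (lintegral_deriv_mul_comp_le (fun r => quartic_hasDerivAt s a b r)
          (fun r hr => quartic_deriv_pos hab hr) (fun x => decay (9 / 8) (c - x))) _)

theorem radial_linear_le (hab : a ^ 2 + b ^ 2 = 1) (c : ℝ) :
    ∫⁻ r in Set.Ioi 0, ENNReal.ofReal r *
      (ENNReal.ofReal (1 + |s - (s / 3 + r * a) - (s / 3 + r * b)|) *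
        decay (7 / 8) (c - ((s / 3 + r * a) ^ 4 + (s / 3 + r * b) ^ 4 +
          (s - (s / 3 + r * a) - (s / 3 + r * b)) ^ 4))) ≤
      4 + 24 * ∫⁻ x, decay (9 / 8) x := by
  set Q := fun r : ℝ => (s / 3 + r * a) ^ 4 + (s / 3 + r * b) ^ 4 +
          (s - (s / 3 + r * a) - (s / 3 + r * b)) ^ 4 with hQ
  set Q' := fun r : ℝ => 4 * r * (s ^ 2 / 3 * (2 * (a ^ 2 + a * b + b ^ 2)) -
    s * r * (3 * (a * b * (a + b))) + r ^ 2 * (2 * (a ^ 2 + a * b + b ^ 2) ^ 2)) with hQ'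
  have hpt : ∀ r ∈ Set.Ioi (0 : ℝ), ENNReal.ofReal r * (ENNReal.ofReal
      (1 + |s - (s / 3 + r * a) - (s / 3 + r * b)|) * decay (7 / 8) (c - Q r)) ≤
      (Set.Ioc (0 : ℝ) 1).indicator (fun _ => 4) r +
        12 * (ENNReal.ofReal (Q' r) *
          (decay (9 / 8) (Q r - s ^ 4 / 27) + decay (9 / 8) (c - Q r))) := by
    intro r hr
    have hr0 : (0 : ℝ) < r := hr
    have hd : 2 / 3 * (r * (s ^ 2 + r ^ 2)) ≤ Q' r := le_quartic_deriv hab hr0.le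
    have hpos : 0 < Q' r := quartic_deriv_pos hab hr0
    obtain ⟨-, ha⟩ := abs_ray_le (s := s) hab hr0.le
    rw [← mul_assoc, ← ENNReal.ofReal_mul hr0.le]
    rcases le_or_gt (s ^ 2 + r ^ 2) 1 with h1 | h1
    · have hr1 : r ≤ 1 := by nlinarith [sq_nonneg s]
      have hs1 : |s| ≤ 1 := abs_le_of_sq_le_sq (by nlinarith) zero_le_one
      rw [Set.indicator_of_mem (show r ∈ Set.Ioc (0 : ℝ) 1 from ⟨hr0, hr1⟩)]
      refine le_trans ?_ le_self_add
      refine (mul_le_of_le_one_right' (decay_le_one (by norm_num) _)).trans ?_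
      rw [show (4 : ℝ≥0∞) = ENNReal.ofReal 4 by simp]
      gcongr
      nlinarith
    · refine le_trans ?_ le_add_self
      have hstep : r * (1 + |s - (s / 3 + r * a) - (s / 3 + r * b)|) ≤
          12 * (Q' r * (1 + |Q r - s ^ 4 / 27|) ^ (-(1 / 4) : ℝ)) := by
        set ρ := √(s ^ 2 + r ^ 2) with hρ
        have hρ2 : ρ ^ 2 = s ^ 2 + r ^ 2 := Real.sq_sqrt (by positivity)
        have hρ1 : 1 < ρ := Real.lt_sqrt_of_sq_lt (by linarith)
        have hsρ : |s| ≤ ρ := Real.abs_le_sqrt (by nlinarith)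
        have hrρ : r ≤ ρ := Real.le_sqrt_of_sq_le (by nlinarith [sq_nonneg s])
        have hq : |Q r - s ^ 4 / 27| ≤ 10 * (s ^ 2 + r ^ 2) ^ 2 := abs_quartic_sub_le hab
        rw [← hρ2] at hq hd
        have hpow : (2 * ρ)⁻¹ ≤ (1 + |Q r - s ^ 4 / 27|) ^ (-(1 / 4) : ℝ) := by
          have : (2 * ρ)⁻¹ = ((2 * ρ) ^ 4) ^ (-(1 / 4) : ℝ) := by
            rw [← Real.rpow_natCast, ← Real.rpow_mul (by positivity), ← Real.rpow_neg_one]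
            norm_num
          rw [this]
          refine Real.rpow_le_rpow_of_nonpos (by positivity) ?_ (by norm_num)
          nlinarith [one_lt_pow₀ hρ1 (n := 4) (by norm_num)]
        calc _ ≤ r * (ρ + (ρ + 2 * ρ)) := by gcongr; linarith
          _ = 12 * (2 / 3 * (r * ρ ^ 2) * (2 * ρ)⁻¹) := by field_simp; ring
          _ ≤ _ := by gcongr
      calc _ ≤ ENNReal.ofReal (12 * (Q' r * (1 + |Q r - s ^ 4 / 27|) ^ (-(1 / 4) : ℝ))) *
            decay (7 / 8) (c - Q r) := by gcongr
        _ = 12 * (ENNReal.ofReal (Q' r) *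
            (decay (1 / 4) (Q r - s ^ 4 / 27) * decay (7 / 8) (c - Q r))) := by
          rw [ENNReal.ofReal_mul (by norm_num),
            ENNReal.ofReal_mul hpos.le, decay.eq_def (1 / 4), mul_assoc, mul_assoc]
          simp only [ENNReal.ofReal_ofNat]
        _ ≤ _ := by
          gcongr
          refine (decay_mul_le_add (by norm_num) (by norm_num) _ _).trans_eq ?_
          norm_num
  have hmain : ∀ g : ℝ → ℝ≥0∞, ∫⁻ r in Set.Ioi 0, ENNReal.ofReal (Q' r) * g (Q r) ≤ ∫⁻ x, g x :=
    fun g => lintegral_deriv_mul_comp_le (fun r => quartic_hasDerivAt s a b r)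
      (fun r hr => quartic_deriv_pos hab hr) g
  calc _ ≤ ∫⁻ r in Set.Ioi 0, ((Set.Ioc (0 : ℝ) 1).indicator (fun _ => 4) r +
        12 * (ENNReal.ofReal (Q' r) *
          (decay (9 / 8) (Q r - s ^ 4 / 27) + decay (9 / 8) (c - Q r)))) :=
        setLIntegral_mono' measurableSet_Ioi hpt
    _ = (∫⁻ r in Set.Ioi 0, (Set.Ioc (0 : ℝ) 1).indicator (fun _ => (4 : ℝ≥0∞)) r) +
        12 * ∫⁻ r in Set.Ioi 0, ENNReal.ofReal (Q' r) *
          (decay (9 / 8) (Q r - s ^ 4 / 27) + decay (9 / 8) (c - Q r)) := by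
      rw [lintegral_add_left (measurable_const.indicator measurableSet_Ioc),
        lintegral_const_mul' _ _ (by norm_num)]
    _ ≤ 4 + 12 * ∫⁻ x, (decay (9 / 8) (x - s ^ 4 / 27) + decay (9 / 8) (c - x)) := by
      exact add_le_add (lintegral_indicator_Ioc_le _) (mul_le_mul_right
        (hmain fun x => decay (9 / 8) (x - s ^ 4 / 27) + decay (9 / 8) (c - x)) _)
    _ = _ := by
      rw [lintegral_add_left (f := fun x => decay (9 / 8) (x - s ^ 4 / 27))
          ((measurable_decay _).comp (measurable_id.sub_const _)),
        lintegral_decay_sub_left, lintegral_decay_sub_right]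
      ring

end radial

theorem exists_lintegral_product_weight_le :
    ∃ C : ℝ≥0∞, C < ∞ ∧ ∀ s c : ℝ, ∫⁻ p : ℝ × ℝ,
      ENNReal.ofReal ((1 + |p.2|) * (1 + |s - p.1 - p.2|)) *
        decay (9 / 8) (c - (p.1 ^ 4 + p.2 ^ 4 + (s - p.1 - p.2) ^ 4)) ≤ C := by
  refine ⟨ENNReal.ofReal (2 * Real.pi) * (12 + 36 * ∫⁻ x, decay (9 / 8) x), ?_, fun s c => ?_⟩
  · have := lintegral_decay_lt_top (p := 9 / 8) (by norm_num)
    exact ENNReal.mul_lt_top ENNReal.ofReal_lt_top (ENNReal.add_lt_top.2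
      ⟨by norm_num, ENNReal.mul_lt_top (by norm_num) this⟩)
  · refine lintegral_plane_le_of_radial_le ?_ (s / 3) (s / 3) fun a b hab =>
      radial_product_le hab c
    have := measurable_decay (9 / 8)
    fun_prop

theorem exists_lintegral_linear_weight_le :
    ∃ C : ℝ≥0∞, C < ∞ ∧ ∀ s c : ℝ, ∫⁻ p : ℝ × ℝ,
      ENNReal.ofReal (1 + |s - p.1 - p.2|) *
        decay (7 / 8) (c - (p.1 ^ 4 + p.2 ^ 4 + (s - p.1 - p.2) ^ 4)) ≤ C := by
  refine ⟨ENNReal.ofReal (2 * Real.pi) * (4 + 24 * ∫⁻ x, decay (9 / 8) x), ?_, fun s c => ?_⟩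
  · have := lintegral_decay_lt_top (p := 9 / 8) (by norm_num)
    exact ENNReal.mul_lt_top ENNReal.ofReal_lt_top (ENNReal.add_lt_top.2
      ⟨by norm_num, ENNReal.mul_lt_top (by norm_num) this⟩)
  · refine lintegral_plane_le_of_radial_le ?_ (s / 3) (s / 3) fun a b hab =>
      radial_linear_le hab c
    have := measurable_decay (7 / 8)
    fun_prop

section fubini

theorem measurePreserving_swap_left {α β γ : Type*} [MeasureSpace α] [MeasureSpace β]
    [MeasureSpace γ] [SFinite (volume : Measure α)] [SFinite (volume : Measure β)]
    [SFinite (volume : Measure γ)] :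
    MeasurePreserving (fun p : α × β × γ => (p.2.1, p.1, p.2.2)) := by
  have h1 := measurePreserving_prodAssoc (volume : Measure β) (volume : Measure α)
    (volume : Measure γ)
  have h2 := (Measure.measurePreserving_swap (μ := (volume : Measure α))
    (ν := (volume : Measure β))).prod (MeasurePreserving.id (volume : Measure γ))
  have h3 := (measurePreserving_prodAssoc (volume : Measure α) (volume : Measure β)
    (volume : Measure γ)).symm
  exact h1.comp (h2.comp h3)

theorem MeasureTheory.MeasurePreserving.id_prodMap {α β γ : Type*} [MeasureSpace α]
    [MeasureSpace β] [MeasureSpace γ] [SFinite (volume : Measure α)]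
    [SFinite (volume : Measure β)] [SFinite (volume : Measure γ)] {f : β → γ}
    (hf : MeasurePreserving f) : MeasurePreserving (Prod.map (id : α → α) f) :=
  (MeasurePreserving.id volume).prod hf

/-- Reordering `(ξ₁, ξ₃, ξ₅, ξ₂, ξ₄) ↦ (ξ₁, ξ₂, ξ₃, ξ₄, ξ₅)`. -/
theorem measurePreserving_interleave_odd :
    MeasurePreserving (fun v : ℝ × ℝ × ℝ × ℝ × ℝ =>
      (v.1, v.2.2.2.1, v.2.1, v.2.2.2.2, v.2.2.1)) := by
  have e3 : MeasurePreserving (fun p : ℝ × ℝ => (p.2, p.1)) := Measure.measurePreserving_swap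
  have e2 : MeasurePreserving (fun p : ℝ × ℝ × ℝ => (p.2.1, p.1, p.2.2)) :=
    measurePreserving_swap_left
  have e1 : MeasurePreserving (fun p : ℝ × ℝ × ℝ × ℝ => (p.2.1, p.1, p.2.2)) :=
    measurePreserving_swap_left
  exact (e1.id_prodMap (α := ℝ)).comp (((e3.id_prodMap (α := ℝ)).id_prodMap (α := ℝ)).id_prodMap
    (α := ℝ) |>.comp ((e2.id_prodMap (α := ℝ)).id_prodMap (α := ℝ)))

/-- Reordering `(ξ₂, ξ₄, ξ₆, ξ₁, ξ₃) ↦ (ξ₁, ξ₂, ξ₃, ξ₄, ξ₆)`. -/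
theorem measurePreserving_interleave_even :
    MeasurePreserving (fun v : ℝ × ℝ × ℝ × ℝ × ℝ =>
      (v.2.2.2.1, v.1, v.2.2.2.2, v.2.1, v.2.2.1)) := by
  have e0 : MeasurePreserving (fun p : ℝ × ℝ × ℝ × ℝ × ℝ => (p.2.1, p.1, p.2.2)) :=
    measurePreserving_swap_left
  have e1 : MeasurePreserving (fun p : ℝ × ℝ × ℝ × ℝ => (p.2.1, p.1, p.2.2)) :=
    measurePreserving_swap_left
  have e2 : MeasurePreserving (fun p : ℝ × ℝ × ℝ => (p.2.1, p.1, p.2.2)) :=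
    measurePreserving_swap_left
  have e3 : MeasurePreserving (fun p : ℝ × ℝ => (p.2, p.1)) := Measure.measurePreserving_swap
  have f1 := e1.id_prodMap (α := ℝ)
  have f2 := (e2.id_prodMap (α := ℝ)).id_prodMap (α := ℝ)
  have f3 := ((e3.id_prodMap (α := ℝ)).id_prodMap (α := ℝ)).id_prodMap (α := ℝ)
  exact f2.comp (f3.comp (e0.comp (f1.comp f2)))

theorem lintegral_reflect_last {f : ℝ × ℝ × ℝ × ℝ × ℝ → ℝ≥0∞} (hf : Measurable f) :
    ∫⁻ w, f w = ∫⁻ w : ℝ × ℝ × ℝ × ℝ × ℝ, f (w.1, w.2.1, w.2.2.1, w.2.2.2.1,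
      -(w.1 + w.2.1 + w.2.2.1 + w.2.2.2.1) - w.2.2.2.2) := by
  simp only [Measure.volume_eq_prod]
  rw [lintegral_prod _ (by fun_prop), lintegral_prod _ (by fun_prop)]
  refine lintegral_congr fun a => ?_
  rw [lintegral_prod _ (by fun_prop), lintegral_prod _ (by fun_prop)]
  refine lintegral_congr fun b => ?_
  rw [lintegral_prod _ (by fun_prop), lintegral_prod _ (by fun_prop)]
  refine lintegral_congr fun c => ?_
  rw [lintegral_prod _ (by fun_prop), lintegral_prod _ (by fun_prop)]
  refine lintegral_congr fun d => ?_
  exact (lintegral_sub_left_eq_self (fun x => f (a, b, c, d, x)) (-(a + b + c + d))).symm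

theorem lintegral_mul_le_of_fiber_le {H : ℝ × ℝ × ℝ × ℝ × ℝ → ℝ≥0∞} (hH : Measurable H)
    {f g h : ℝ → ℝ≥0∞} (hf : Measurable f) (hg : Measurable g) (hh : Measurable h) {C : ℝ≥0∞}
    (hC : ∀ x y z : ℝ, ∫⁻ p : ℝ × ℝ, H (x, y, z, p) ≤ C) :
    ∫⁻ v : ℝ × ℝ × ℝ × ℝ × ℝ, f v.1 * g v.2.1 * h v.2.2.1 * H v ≤
      C * ((∫⁻ x, f x) * (∫⁻ x, g x) * ∫⁻ x, h x) := by
  have key : ∀ x y z : ℝ, ∫⁻ p : ℝ × ℝ, f x * g y * h z * H (x, y, z, p) ≤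
      f x * g y * h z * C := by
    intro x y z
    rw [lintegral_const_mul _ (by fun_prop)]
    gcongr
    exact hC x y z
  calc _ = ∫⁻ x, ∫⁻ y, ∫⁻ z, ∫⁻ p : ℝ × ℝ, f x * g y * h z * H (x, y, z, p) := by
        simp only [Measure.volume_eq_prod]
        rw [lintegral_prod _ (by fun_prop)]
        refine lintegral_congr fun a => ?_
        rw [lintegral_prod _ (by fun_prop)]
        refine lintegral_congr fun b => ?_
        rw [lintegral_prod _ (by fun_prop)]
    _ ≤ ∫⁻ x, ∫⁻ y, ∫⁻ z, f x * g y * h z * C := by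
        gcongr with x y z
        exact key x y z
    _ = _ := by
        have e1 : ∀ x y, ∫⁻ z, f x * g y * h z * C = f x * (g y * ((∫⁻ z, h z) * C)) := by
          intro x y
          rw [lintegral_mul_const _ (by fun_prop), lintegral_const_mul _ hh, mul_assoc, mul_assoc]
        have e2 : ∀ x, ∫⁻ y, f x * (g y * ((∫⁻ z, h z) * C)) =
            f x * ((∫⁻ y, g y) * ((∫⁻ z, h z) * C)) := by
          intro x
          rw [lintegral_const_mul _ (by fun_prop), lintegral_mul_const _ hg]
        simp_rw [e1, e2]
        rw [lintegral_mul_const _ hf]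
        ring

end fubini

theorem measurable_sigma4 {m : ℝ → ℝ} (hm : Measurable m) :
    Measurable fun p : ℝ × ℝ × ℝ × ℝ => sigma4 m p.1 p.2.1 p.2.2.1 p.2.2.2 := by
  unfold sigma4
  refine Measurable.ite (measurableSet_eq_fun (by fun_prop) measurable_const) measurable_const ?_
  fun_prop

theorem exists_weighted_form_le : ∃ K : ℝ≥0∞, K < ∞ ∧ ∀ (Λ : ℝ) (G₁ G₂ G₃ G₄ G₅ G₆ : ℝ → ℝ≥0∞),
    Measurable G₁ → Measurable G₂ → Measurable G₃ → Measurable G₄ → Measurable G₅ →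
    Measurable G₆ →
    ∫⁻ w : ℝ × ℝ × ℝ × ℝ × ℝ,
      ENNReal.ofReal ((1 + |w.2.2.2.2|) * ((1 + |w.2.2.2.1|) *
        (1 + |-(w.1 + w.2.1 + w.2.2.1 + w.2.2.2.1 + w.2.2.2.2)|))) ^ (1 / 2 : ℝ) *
      decay 1 (Λ - (w.1 ^ 4 - w.2.1 ^ 4 + w.2.2.1 ^ 4 - w.2.2.2.1 ^ 4 + w.2.2.2.2 ^ 4 -
        (-(w.1 + w.2.1 + w.2.2.1 + w.2.2.2.1 + w.2.2.2.2)) ^ 4)) *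
      (G₁ w.1 * G₂ w.2.1 * G₃ w.2.2.1 * G₄ w.2.2.2.1 * G₅ w.2.2.2.2 *
        G₆ (-(w.1 + w.2.1 + w.2.2.1 + w.2.2.2.1 + w.2.2.2.2))) ≤
    K * ((∫⁻ x, G₁ x ^ 2) ^ (1 / 2 : ℝ) * (∫⁻ x, G₂ x ^ 2) ^ (1 / 2 : ℝ) *
      (∫⁻ x, G₃ x ^ 2) ^ (1 / 2 : ℝ) * (∫⁻ x, G₄ x ^ 2) ^ (1 / 2 : ℝ) *
      (∫⁻ x, G₅ x ^ 2) ^ (1 / 2 : ℝ) * (∫⁻ x, G₆ x ^ 2) ^ (1 / 2 : ℝ)) := by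
  obtain ⟨CA, hCA, hA⟩ := exists_lintegral_linear_weight_le
  obtain ⟨CB, hCB, hB⟩ := exists_lintegral_product_weight_le
  refine ⟨CB ^ (1 / 2 : ℝ) * CA ^ (1 / 2 : ℝ), ENNReal.mul_lt_top
    (ENNReal.rpow_lt_top_of_nonneg (by norm_num) hCB.ne)
    (ENNReal.rpow_lt_top_of_nonneg (by norm_num) hCA.ne), ?_⟩
  intro Λ G₁ G₂ G₃ G₄ G₅ G₆ h1 h2 h3 h4 h5 h6
  have hd8 := measurable_decay (9 / 8)
  have hd7 := measurable_decay (7 / 8)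
  set Φ : ℝ × ℝ × ℝ × ℝ × ℝ → ℝ := fun w => Λ - (w.1 ^ 4 - w.2.1 ^ 4 + w.2.2.1 ^ 4 -
    w.2.2.2.1 ^ 4 + w.2.2.2.2 ^ 4 -
    (-(w.1 + w.2.1 + w.2.2.1 + w.2.2.2.1 + w.2.2.2.2)) ^ 4) with hΦ
  set z : ℝ × ℝ × ℝ × ℝ × ℝ → ℝ := fun w =>
    -(w.1 + w.2.1 + w.2.2.1 + w.2.2.2.1 + w.2.2.2.2) with hz
  set X : ℝ × ℝ × ℝ × ℝ × ℝ → ℝ≥0∞ := fun w => G₁ w.1 ^ 2 * G₃ w.2.2.1 ^ 2 * G₅ w.2.2.2.2 ^ 2 *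
    (ENNReal.ofReal ((1 + |w.2.2.2.1|) * (1 + |z w|)) * decay (9 / 8) (Φ w)) with hX
  set Y : ℝ × ℝ × ℝ × ℝ × ℝ → ℝ≥0∞ := fun w => G₂ w.2.1 ^ 2 * G₄ w.2.2.2.1 ^ 2 * G₆ (z w) ^ 2 *
    (ENNReal.ofReal (1 + |w.2.2.2.2|) * decay (7 / 8) (Φ w)) with hY
  have hXm : Measurable X := by fun_prop
  have hYm : Measurable Y := by fun_prop
  have hpt : ∀ w : ℝ × ℝ × ℝ × ℝ × ℝ,
      ENNReal.ofReal ((1 + |w.2.2.2.2|) * ((1 + |w.2.2.2.1|) * (1 + |z w|))) ^ (1 / 2 : ℝ) *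
        decay 1 (Φ w) * (G₁ w.1 * G₂ w.2.1 * G₃ w.2.2.1 * G₄ w.2.2.2.1 * G₅ w.2.2.2.2 *
        G₆ (z w)) = X w ^ (1 / 2 : ℝ) * Y w ^ (1 / 2 : ℝ) := by
    intro w
    have hsq : ∀ x : ℝ≥0∞, x = (x ^ 2) ^ (1 / 2 : ℝ) := fun x => by
      rw [← ENNReal.rpow_natCast, ← ENNReal.rpow_mul]; norm_num
    rw [hsq (decay 1 (Φ w)), hsq (G₁ w.1 * _ * _ * _ * _ * _),
      ← ENNReal.mul_rpow_of_nonneg _ _ (by norm_num), ← ENNReal.mul_rpow_of_nonneg _ _ (by norm_num),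
      ← ENNReal.mul_rpow_of_nonneg _ _ (by norm_num)]
    congr 1
    have hdec : decay 1 (Φ w) ^ 2 = decay (9 / 8) (Φ w) * decay (7 / 8) (Φ w) := by
      rw [sq, decay_mul, decay_mul]; norm_num
    rw [hdec, ENNReal.ofReal_mul (by positivity)]
    simp only [hX, hY]
    ring
  have hXle : ∫⁻ w, X w ≤ CB * ((∫⁻ x, G₁ x ^ 2) * (∫⁻ x, G₃ x ^ 2) * ∫⁻ x, G₅ x ^ 2) := by
    rw [← measurePreserving_interleave_odd.lintegral_comp hXm]
    refine lintegral_mul_le_of_fiber_le (H := fun v => ENNReal.ofReal ((1 + |v.2.2.2.2|) *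
      (1 + |z (v.1, v.2.2.2.1, v.2.1, v.2.2.2.2, v.2.2.1)|)) *
      decay (9 / 8) (Φ (v.1, v.2.2.2.1, v.2.1, v.2.2.2.2, v.2.2.1)))
      (by fun_prop) (h1.pow_const 2) (h3.pow_const 2) (h5.pow_const 2) fun x₁ x₃ x₅ => ?_
    refine le_trans (le_of_eq ?_) (hB (-x₁ - x₃ - x₅) (-(Λ - (x₁ ^ 4 + x₃ ^ 4 + x₅ ^ 4))))
    refine lintegral_congr fun p => ?_
    have e : z (x₁, p.1, x₃, p.2, x₅) = -x₁ - x₃ - x₅ - p.1 - p.2 := by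
      simp only [hz]; ring
    simp only [e]
    congr 1
    rw [← decay_neg]
    congr 1
    simp only [hΦ]; ring
  have hYle : ∫⁻ w, Y w ≤ CA * ((∫⁻ x, G₂ x ^ 2) * (∫⁻ x, G₄ x ^ 2) * ∫⁻ x, G₆ x ^ 2) := by
    rw [lintegral_reflect_last hYm, ← measurePreserving_interleave_even.lintegral_comp (by fun_prop)]
    set ψ : ℝ × ℝ × ℝ × ℝ × ℝ → ℝ × ℝ × ℝ × ℝ × ℝ := fun v => (v.2.2.2.1, v.1, v.2.2.2.2, v.2.1,
      -(v.2.2.2.1 + v.1 + v.2.2.2.2 + v.2.1) - v.2.2.1) with hψ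
    have hzψ : ∀ v, z (ψ v) = v.2.2.1 := fun v => by simp only [hz, hψ]; ring
    refine le_trans (le_of_eq (lintegral_congr fun v => ?_)) (lintegral_mul_le_of_fiber_le
      (H := fun v => ENNReal.ofReal (1 + |(ψ v).2.2.2.2|) * decay (7 / 8) (Φ (ψ v)))
      (by fun_prop) (h2.pow_const 2) (h4.pow_const 2) (h6.pow_const 2) fun x₂ x₄ x₆ => ?_)
    · change Y (ψ v) = _
      simp only [hY, hzψ]
      rfl
    refine le_trans (le_of_eq ?_) (hA (-x₂ - x₄ - x₆) (Λ + (x₂ ^ 4 + x₄ ^ 4 + x₆ ^ 4)))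
    refine lintegral_congr fun p => ?_
    have e : (ψ (x₂, x₄, x₆, p)).2.2.2.2 = -x₂ - x₄ - x₆ - p.1 - p.2 := by
      simp only [hψ]; ring
    simp only [e]
    congr 2
    simp only [hΦ, hψ]; ring
  calc _ = ∫⁻ w, X w ^ (1 / 2 : ℝ) * Y w ^ (1 / 2 : ℝ) := lintegral_congr hpt
    _ ≤ (∫⁻ w, X w) ^ (1 / 2 : ℝ) * (∫⁻ w, Y w) ^ (1 / 2 : ℝ) :=
      ENNReal.lintegral_mul_norm_pow_le hXm.aemeasurable hYm.aemeasurable (by norm_num)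
        (by norm_num) (by norm_num)
    _ ≤ (CB * ((∫⁻ x, G₁ x ^ 2) * (∫⁻ x, G₃ x ^ 2) * ∫⁻ x, G₅ x ^ 2)) ^ (1 / 2 : ℝ) *
        (CA * ((∫⁻ x, G₂ x ^ 2) * (∫⁻ x, G₄ x ^ 2) * ∫⁻ x, G₆ x ^ 2)) ^ (1 / 2 : ℝ) := by
      gcongr
    _ = _ := by
      simp only [ENNReal.mul_rpow_of_nonneg _ _ (show (0 : ℝ) ≤ 1 / 2 by norm_num)]
      ring

/-- The positive six-linear estimate at fixed modulations. -/
theorem exists_sigma4_form_le {C₀ : ℝ} (hC₀ : 0 ≤ C₀) : ∃ K : ℝ, 0 < K ∧ ∀ N : ℝ, 1 ≤ N →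
    ∀ m : ℝ → ℝ, IsIMultiplier N C₀ m → ∀ (Λ : ℝ) (F₁ F₂ F₃ F₄ F₅ F₆ : ℝ → ℝ≥0∞),
    Measurable F₁ → Measurable F₂ → Measurable F₃ → Measurable F₄ → Measurable F₅ →
    Measurable F₆ →
    ∫⁻ w : ℝ × ℝ × ℝ × ℝ × ℝ,
      ENNReal.ofReal |sigma4 m w.1 w.2.1 w.2.2.1 (-w.1 - w.2.1 - w.2.2.1)| *
      decay 1 (Λ - (w.1 ^ 4 - w.2.1 ^ 4 + w.2.2.1 ^ 4 - w.2.2.2.1 ^ 4 + w.2.2.2.2 ^ 4 -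
        (-(w.1 + w.2.1 + w.2.2.1 + w.2.2.2.1 + w.2.2.2.2)) ^ 4)) *
      (F₁ w.1 * F₂ w.2.1 * F₃ w.2.2.1 * F₄ w.2.2.2.1 * F₅ w.2.2.2.2 *
        F₆ (-(w.1 + w.2.1 + w.2.2.1 + w.2.2.2.1 + w.2.2.2.2))) ≤
    ENNReal.ofReal (K * N ^ (-(3 : ℝ))) *
      ((∫⁻ x, (ENNReal.ofReal (m x) * F₁ x) ^ 2) ^ (1 / 2 : ℝ) *
      (∫⁻ x, (ENNReal.ofReal (m x) * F₂ x) ^ 2) ^ (1 / 2 : ℝ) *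
      (∫⁻ x, (ENNReal.ofReal (m x) * F₃ x) ^ 2) ^ (1 / 2 : ℝ) *
      (∫⁻ x, (ENNReal.ofReal (m x) * F₄ x) ^ 2) ^ (1 / 2 : ℝ) *
      (∫⁻ x, (ENNReal.ofReal (m x) * F₅ x) ^ 2) ^ (1 / 2 : ℝ) *
      (∫⁻ x, (ENNReal.ofReal (m x) * F₆ x) ^ 2) ^ (1 / 2 : ℝ)) := by
  obtain ⟨K, hK, h⟩ := exists_weighted_form_le
  refine ⟨128 * C₀ * K.toReal + 1, by positivity, ?_⟩
  intro N hN m hm Λ F₁ F₂ F₃ F₄ F₅ F₆ h1 h2 h3 h4 h5 h6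
  have hN3 : 0 ≤ N ^ (-(3 : ℝ)) := by positivity
  have hm0 : ∀ x, 0 ≤ m x := fun x => (hm.2.2.1 x).1
  have hmm : Measurable fun x => ENNReal.ofReal (m x) := hm.1.continuous.measurable.ennreal_ofReal
  have hmF : ∀ {F : ℝ → ℝ≥0∞}, Measurable F → Measurable fun x => ENNReal.ofReal (m x) * F x :=
    fun hF => hmm.mul hF
  set L := 128 * C₀ * N ^ (-(3 : ℝ)) with hL
  have hL0 : 0 ≤ L := by positivity
  have hσ : ∀ x₁ x₂ x₃ x₄ x₅ x₆ : ℝ, ENNReal.ofReal |sigma4 m x₁ x₂ x₃ (-x₁ - x₂ - x₃)| ≤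
      ENNReal.ofReal L *
        (ENNReal.ofReal ((1 + |x₅|) * ((1 + |x₄|) * (1 + |x₆|))) ^ (1 / 2 : ℝ) *
        (ENNReal.ofReal (m x₁) * ENNReal.ofReal (m x₂) * ENNReal.ofReal (m x₃) *
          ENNReal.ofReal (m x₄) * ENNReal.ofReal (m x₅) * ENNReal.ofReal (m x₆))) := by
    intro x₁ x₂ x₃ x₄ x₅ x₆
    have hs := hm.sq_sigma4_le hN hC₀ x₁ x₂ x₃ x₄ x₅ x₆
    rw [← hL] at hs
    have := hm0 x₁
    have := hm0 x₂
    have := hm0 x₃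
    have := hm0 x₄
    have := hm0 x₅
    have := hm0 x₆
    have hs2 : |sigma4 m x₁ x₂ x₃ (-x₁ - x₂ - x₃)| ≤ L *
        (((1 + |x₅|) * ((1 + |x₄|) * (1 + |x₆|))) ^ (1 / 2 : ℝ) *
          (m x₁ * m x₂ * m x₃ * m x₄ * m x₅ * m x₆)) := by
      rw [← Real.sqrt_eq_rpow]
      refine abs_le_of_sq_le_sq ?_ (by positivity)
      refine hs.trans_eq ?_
      rw [mul_pow L, mul_pow (√_), Real.sq_sqrt (by positivity), mul_assoc]
    refine (ENNReal.ofReal_le_ofReal hs2).trans_eq ?_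
    rw [ENNReal.ofReal_mul (p := L) hL0, ENNReal.ofReal_mul (p := _ ^ (1 / 2 : ℝ)) (by positivity),
      ENNReal.ofReal_rpow_of_nonneg (by positivity) (by norm_num)]
    rw [ENNReal.ofReal_mul' (hm0 x₆), ENNReal.ofReal_mul' (hm0 x₅), ENNReal.ofReal_mul' (hm0 x₄),
      ENNReal.ofReal_mul' (hm0 x₃), ENNReal.ofReal_mul' (hm0 x₂)]
  calc _ ≤ ∫⁻ w : ℝ × ℝ × ℝ × ℝ × ℝ, ENNReal.ofReal L *
      (ENNReal.ofReal ((1 + |w.2.2.2.2|) * ((1 + |w.2.2.2.1|) *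
        (1 + |-(w.1 + w.2.1 + w.2.2.1 + w.2.2.2.1 + w.2.2.2.2)|))) ^ (1 / 2 : ℝ) *
      decay 1 (Λ - (w.1 ^ 4 - w.2.1 ^ 4 + w.2.2.1 ^ 4 - w.2.2.2.1 ^ 4 + w.2.2.2.2 ^ 4 -
        (-(w.1 + w.2.1 + w.2.2.1 + w.2.2.2.1 + w.2.2.2.2)) ^ 4)) *
      ((ENNReal.ofReal (m w.1) * F₁ w.1) * (ENNReal.ofReal (m w.2.1) * F₂ w.2.1) *
        (ENNReal.ofReal (m w.2.2.1) * F₃ w.2.2.1) *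
        (ENNReal.ofReal (m w.2.2.2.1) * F₄ w.2.2.2.1) *
        (ENNReal.ofReal (m w.2.2.2.2) * F₅ w.2.2.2.2) *
        (ENNReal.ofReal (m (-(w.1 + w.2.1 + w.2.2.1 + w.2.2.2.1 + w.2.2.2.2))) *
          F₆ (-(w.1 + w.2.1 + w.2.2.1 + w.2.2.2.1 + w.2.2.2.2))))) := by
        refine lintegral_mono fun w => ?_
        refine (mul_le_mul_left (mul_le_mul_left (hσ w.1 w.2.1 w.2.2.1 w.2.2.2.1 w.2.2.2.2
          (-(w.1 + w.2.1 + w.2.2.1 + w.2.2.2.1 + w.2.2.2.2))) _) _).trans_eq ?_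
        ring
    _ ≤ ENNReal.ofReal L * (K * _) := by
        rw [lintegral_const_mul' _ _ ENNReal.ofReal_ne_top]
        exact mul_le_mul_right (h Λ _ _ _ _ _ _ (hmF h1) (hmF h2) (hmF h3) (hmF h4) (hmF h5)
          (hmF h6)) _
    _ ≤ _ := by
        rw [← mul_assoc]
        refine mul_le_mul_left ?_ _
        conv_lhs => rw [← ENNReal.ofReal_toReal hK.ne]
        rw [← ENNReal.ofReal_mul hL0]
        refine ENNReal.ofReal_le_ofReal ?_
        rw [hL]
        nlinarith

theorem abs_iteratedDeriv_rpow_le (r : ℝ) (hr : r ≤ 0) (n : ℕ) {x : ℝ} (hx : 1 ≤ x) :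
    |iteratedDeriv n (fun y : ℝ => y ^ r) x| ≤ |(descPochhammer ℝ n).eval r| := by
  have hx0 : 0 < x := by linarith
  rw [iteratedDeriv_eq_iterate, Real.iter_deriv_rpow_const r x n, abs_mul,
    abs_of_nonneg (Real.rpow_nonneg hx0.le _)]
  refine mul_le_of_le_one_right (abs_nonneg _) (Real.rpow_le_one_of_one_le_of_nonpos hx ?_)
  have : (0 : ℝ) ≤ n := n.cast_nonneg
  linarith

theorem IsIMultiplier.hasTemperateGrowth {N C₀ : ℝ} {m : ℝ → ℝ} (hm : IsIMultiplier N C₀ m)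
    (hN : 1 ≤ N) : m.HasTemperateGrowth := by
  obtain ⟨hsm, hev, -, -, -, htail, -⟩ := hm
  refine ⟨hsm, fun n => ?_⟩
  have hcont : Continuous (iteratedDeriv n m) :=
    hsm.continuous_iteratedDeriv n (by exact_mod_cast le_top)
  obtain ⟨A, hA⟩ := (isCompact_Icc (a := -(2 * N)) (b := 2 * N)).exists_bound_of_continuousOn
    hcont.continuousOn
  have hbig : ∀ x, 2 * N < x →
      |iteratedDeriv n m x| ≤ N ^ (1/2 : ℝ) * |(descPochhammer ℝ n).eval (-(1/2) : ℝ)| := by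
    intro x hx
    have heq : m =ᶠ[nhds x] fun y => N ^ (1/2 : ℝ) * y ^ (-(1/2) : ℝ) := by
      filter_upwards [lt_mem_nhds hx] with y hy
      have hy0 : 0 < y := by linarith
      rw [htail y (by rw [abs_of_pos hy0]; exact hy.le), abs_of_pos hy0,
        Real.div_rpow hy0.le (by linarith), Real.rpow_neg (by linarith : (0 : ℝ) ≤ N), div_inv_eq_mul,
        mul_comm]
    rw [heq.iteratedDeriv_eq, iteratedDeriv_const_mul_field, abs_mul,
      abs_of_nonneg (Real.rpow_nonneg (by linarith) _)]
    exact mul_le_mul_of_nonneg_left (abs_iteratedDeriv_rpow_le _ (by norm_num) n (by linarith))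
      (Real.rpow_nonneg (by linarith) _)
  have habs : ∀ x, |iteratedDeriv n m (-x)| = |iteratedDeriv n m x| := by
    intro x
    have h := iteratedDeriv_comp_neg n m x
    have h' : (fun x => m (-x)) = m := funext hev
    rw [h'] at h
    rw [h, smul_eq_mul, abs_mul, abs_pow, abs_neg, abs_one, one_pow, one_mul]
  refine ⟨0, max A (N ^ (1/2 : ℝ) * |(descPochhammer ℝ n).eval (-(1/2) : ℝ)|), fun x => ?_⟩
  rw [norm_iteratedFDeriv_eq_norm_iteratedDeriv, pow_zero, mul_one, Real.norm_eq_abs]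
  rcases le_or_gt |x| (2 * N) with h | h
  · exact (hA x (abs_le.mp h)).trans (le_max_left _ _)
  · refine le_trans ?_ (le_max_right _ _)
    rcases abs_cases x with ⟨h1, -⟩ | ⟨h1, -⟩
    · exact hbig x (by linarith)
    · rw [← habs]; exact hbig (-x) (by linarith)

section fourier

open scoped FourierTransform SchwartzMap

theorem spaceTimeFT_eq_fourier (v : ℝ × ℝ → ℂ) (τ ξ : ℝ) :
    spaceTimeFT v τ ξ = 𝓕 (fun p : WithLp 2 (ℝ × ℝ) => v (WithLp.ofLp p))
      (WithLp.toLp 2 (τ / (2 * Real.pi), ξ / (2 * Real.pi))) := by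
  have hpi : (Real.pi : ℂ) ≠ 0 := by exact_mod_cast Real.pi_ne_zero
  rw [Real.fourier_eq', ← (WithLp.volume_preserving_toLp ℝ ℝ).integral_comp
    (MeasurableEquiv.toLp 2 (ℝ × ℝ)).measurableEmbedding]
  refine integral_congr_ae (Filter.Eventually.of_forall fun p => ?_)
  simp only [smul_eq_mul, WithLp.prod_inner_apply, RCLike.inner_apply, conj_trivial]
  congr 2
  push_cast
  field_simp

/-- A Schwartz function on `ℝ × ℝ`, transported to the Euclidean plane. -/
noncomputable def euclideanSchwartz : 𝓢(ℝ × ℝ, ℂ) →L[ℂ] 𝓢(WithLp 2 (ℝ × ℝ), ℂ) :=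
  SchwartzMap.compCLMOfContinuousLinearEquiv ℂ (WithLp.prodContinuousLinearEquiv 2 ℝ ℝ ℝ)

theorem spaceTimeFT_schwartz (u : 𝓢(ℝ × ℝ, ℂ)) (τ ξ : ℝ) :
    spaceTimeFT (fun p => u p) τ ξ = 𝓕 (euclideanSchwartz u)
      (WithLp.toLp 2 (τ / (2 * Real.pi), ξ / (2 * Real.pi))) := by
  rw [spaceTimeFT_eq_fourier, SchwartzMap.fourier_coe]
  rfl

theorem continuous_spaceTimeFT (u : 𝓢(ℝ × ℝ, ℂ)) :
    Continuous fun q : ℝ × ℝ => spaceTimeFT (fun p => u p) q.1 q.2 := by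
  simp_rw [spaceTimeFT_schwartz]
  refine (SchwartzMap.continuous _).comp ?_
  fun_prop

theorem schwartz_exists_decay (f : 𝓢(WithLp 2 (ℝ × ℝ), ℂ)) (k : ℕ) :
    ∃ C : ℝ, 0 ≤ C ∧ ∀ x y : ℝ,
      ‖f (WithLp.toLp 2 (x, y))‖ ≤ C * (((1 + |x|) ^ k)⁻¹ * ((1 + |y|) ^ k)⁻¹) := by
  refine ⟨2 ^ (2 * k) * ((Finset.Iic (2 * k, 0)).sup
    fun m => SchwartzMap.seminorm ℝ m.1 m.2) f, by positivity, fun x y => ?_⟩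
  have h := SchwartzMap.one_add_le_sup_seminorm_apply (𝕜 := ℝ) (m := (2 * k, 0)) (k := 2 * k)
    (n := 0) le_rfl le_rfl f (WithLp.toLp 2 (x, y))
  rw [norm_iteratedFDeriv_zero] at h
  set p : WithLp 2 (ℝ × ℝ) := WithLp.toLp 2 (x, y) with hp
  have h1 : |x| ≤ ‖p‖ := by
    exact WithLp.norm_fst_le ℝ p
  have h2 : |y| ≤ ‖p‖ := by
    exact WithLp.norm_snd_le ℝ p
  rw [← mul_inv, ← div_eq_mul_inv, le_div_iff₀ (by positivity)]
  refine le_trans ?_ h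
  rw [mul_comm, pow_mul', pow_two]
  gcongr

theorem spaceTimeFT_exists_decay (u : 𝓢(ℝ × ℝ, ℂ)) :
    ∃ C : ℝ, 0 ≤ C ∧ ∀ τ ξ : ℝ, ‖spaceTimeFT (fun p => u p) τ ξ‖ ≤
      C * (((1 + |τ|) ^ 2)⁻¹ * ((1 + |ξ|) ^ 2)⁻¹) := by
  obtain ⟨C, hC, h⟩ := schwartz_exists_decay (𝓕 (euclideanSchwartz u)) 2
  refine ⟨C * (2 * Real.pi) ^ 4, by positivity, fun τ ξ => ?_⟩
  rw [spaceTimeFT_schwartz]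
  refine (h _ _).trans ?_
  have key : ∀ x : ℝ, ((1 + |x / (2 * Real.pi)|) ^ 2)⁻¹ ≤
      (2 * Real.pi) ^ 2 * ((1 + |x|) ^ 2)⁻¹ := by
    intro x
    have hpi : 1 ≤ 2 * Real.pi := by linarith [Real.pi_gt_three]
    have hp : 0 < 2 * Real.pi := by linarith
    rw [abs_div, abs_of_pos hp, ← div_eq_mul_inv, inv_le_comm₀ (by positivity) (by positivity),
      inv_div, ← div_pow]
    gcongr
    rw [add_div]
    gcongr
    exact div_le_one_of_le₀ hpi hp.le
  calc _ ≤ C * (((2 * Real.pi) ^ 2 * ((1 + |τ|) ^ 2)⁻¹) * ((2 * Real.pi) ^ 2 * ((1 + |ξ|) ^ 2)⁻¹)) := by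
        gcongr
        · exact key τ
        · exact key ξ
    _ = _ := by ring

theorem integrable_inv_one_add_abs_sq : Integrable fun x : ℝ => ((1 + |x|) ^ 2)⁻¹ := by
  refine integrable_inv_one_add_sq.mono' (by fun_prop) (Filter.Eventually.of_forall fun x => ?_)
  rw [Real.norm_eq_abs, abs_of_nonneg (by positivity)]
  gcongr
  nlinarith [abs_nonneg x, sq_abs x]

theorem norm_integral_le_mul_integral_inv {f : ℝ → ℂ} {A : ℝ}
    (h : ∀ x, ‖f x‖ ≤ A * ((1 + |x|) ^ 2)⁻¹) :
    ‖∫ x, f x‖ ≤ A * ∫ x : ℝ, ((1 + |x|) ^ 2)⁻¹ := by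
  rw [← integral_const_mul]
  exact norm_integral_le_of_norm_le (integrable_inv_one_add_abs_sq.const_mul A)
    (Filter.Eventually.of_forall h)

theorem norm_exp_neg_I_mul (x ξ : ℝ) : ‖Complex.exp (-(Complex.I * x * ξ))‖ = 1 := by
  rw [show -(Complex.I * x * ξ) = ((-(x * ξ) : ℝ) : ℂ) * Complex.I by push_cast; ring]
  exact Complex.norm_exp_ofReal_mul_I _

theorem norm_exp_I_mul (x ξ : ℝ) : ‖Complex.exp (Complex.I * x * ξ)‖ = 1 := by
  rw [show Complex.I * x * ξ = ((x * ξ : ℝ) : ℂ) * Complex.I by push_cast; ring]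
  exact Complex.norm_exp_ofReal_mul_I _

/-- Fourier inversion on the line in the normalization without `2π` in the phase. -/
theorem integral_exp_mul_inversion {h : ℝ → ℂ} (hc : Continuous h) (hi : Integrable h)
    (hF : Integrable fun τ : ℝ => ∫ t : ℝ, Complex.exp (-(Complex.I * t * τ)) * h t) (t : ℝ) :
    h t = (2 * Real.pi)⁻¹ * ∫ τ : ℝ, Complex.exp (Complex.I * t * τ) *
      ∫ s : ℝ, Complex.exp (-(Complex.I * s * τ)) * h s := by
  have hpi : (0 : ℝ) < 2 * Real.pi := by positivity
  have hpic : (Real.pi : ℂ) ≠ 0 := by exact_mod_cast Real.pi_ne_zero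
  have hFe : ∀ w : ℝ, 𝓕 h w = ∫ s : ℝ, Complex.exp (-(Complex.I * s * (2 * Real.pi * w : ℝ))) * h s := by
    intro w
    rw [Real.fourier_real_eq_integral_exp_smul]
    refine integral_congr_ae (Filter.Eventually.of_forall fun s => ?_)
    simp only [smul_eq_mul]
    congr 2
    push_cast
    ring
  have hFi : Integrable (𝓕 h) := by
    rw [show 𝓕 h = _ from funext hFe]
    exact hF.comp_mul_left' hpi.ne'
  have h1 := congrFun (hc.fourierInv_fourier_eq hi hFi) t
  rw [Real.fourierInv_eq'] at h1
  rw [← h1]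
  simp only [hFe, smul_eq_mul, RCLike.inner_apply, conj_trivial]
  have h2 := Measure.integral_comp_mul_left (fun τ : ℝ => Complex.exp (Complex.I * t * τ) *
    ∫ s : ℝ, Complex.exp (-(Complex.I * s * τ)) * h s) (2 * Real.pi)
  rw [abs_of_pos (by positivity)] at h2
  rw [Complex.real_smul] at h2
  push_cast at h2 ⊢
  rw [← h2]
  refine integral_congr_ae (Filter.Eventually.of_forall fun s => ?_)
  simp only
  congr 2
  ring

theorem schwartz_plane_exists_decay (u : 𝓢(ℝ × ℝ, ℂ)) :
    ∃ C : ℝ, 0 ≤ C ∧ ∀ t x : ℝ, ‖u (t, x)‖ ≤ C * (((1 + |t|) ^ 2)⁻¹ * ((1 + |x|) ^ 2)⁻¹) :=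
  schwartz_exists_decay (euclideanSchwartz u) 2

theorem continuous_fourierIntX (u : 𝓢(ℝ × ℝ, ℂ)) :
    Continuous fun q : ℝ × ℝ => fourierIntX (fun p => u p) q.1 q.2 := by
  obtain ⟨C, hC, h⟩ := schwartz_plane_exists_decay u
  have hu := u.continuous
  refine continuous_of_dominated (bound := fun x => C * ((1 + |x|) ^ 2)⁻¹) (fun q => ?_) (fun q => ?_)
    (integrable_inv_one_add_abs_sq.const_mul C) (Filter.Eventually.of_forall fun x => ?_)
  · exact Continuous.aestronglyMeasurable (by fun_prop)
  · refine Filter.Eventually.of_forall fun x => ?_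
    rw [norm_mul, norm_exp_neg_I_mul, one_mul]
    refine (h _ _).trans ?_
    gcongr
    refine mul_le_of_le_one_left (by positivity) (inv_le_one_of_one_le₀ (one_le_pow₀ ?_))
    linarith [abs_nonneg q.1]
  · fun_prop

theorem integrable_fourierIntX_time (u : 𝓢(ℝ × ℝ, ℂ)) (ξ : ℝ) :
    Integrable fun t => fourierIntX (fun p => u p) t ξ := by
  obtain ⟨C, hC, h⟩ := schwartz_plane_exists_decay u
  refine (integrable_inv_one_add_abs_sq.const_mul (C * ∫ x : ℝ, ((1 + |x|) ^ 2)⁻¹)).mono'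
    ((continuous_fourierIntX u).comp (by fun_prop : Continuous fun t : ℝ => (t, ξ))).aestronglyMeasurable
    (Filter.Eventually.of_forall fun t => ?_)
  unfold fourierIntX
  refine (norm_integral_le_mul_integral_inv (A := C * ((1 + |t|) ^ 2)⁻¹) fun x => ?_).trans_eq
    (by ring)
  rw [norm_mul, norm_exp_neg_I_mul, one_mul, mul_assoc]
  exact h _ _

theorem integral_exp_mul_fourierIntX (u : 𝓢(ℝ × ℝ, ℂ)) (τ ξ : ℝ) :
    ∫ t : ℝ, Complex.exp (-(Complex.I * t * τ)) * fourierIntX (fun p => u p) t ξ =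
      spaceTimeFT (fun p => u p) τ ξ := by
  have h_int : Integrable fun p : ℝ × ℝ => Complex.exp (-(Complex.I * (p.1 * τ + p.2 * ξ))) * u p := by
    refine u.integrable.norm.mono' (Continuous.aestronglyMeasurable ?_)
      (Filter.Eventually.of_forall fun p => ?_)
    · have := u.continuous
      fun_prop
    · rw [norm_mul, show -(Complex.I * (p.1 * τ + p.2 * ξ)) =
        ((-(p.1 * τ + p.2 * ξ) : ℝ) : ℂ) * Complex.I by push_cast; ring,
        Complex.norm_exp_ofReal_mul_I, one_mul]
  unfold spaceTimeFT
  rw [Measure.volume_eq_prod] at h_int ⊢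
  rw [integral_prod _ h_int]
  refine integral_congr_ae (Filter.Eventually.of_forall fun t => ?_)
  simp only [fourierIntX]
  rw [← integral_const_mul]
  refine integral_congr_ae (Filter.Eventually.of_forall fun x => ?_)
  simp only
  rw [← mul_assoc, ← Complex.exp_add]
  congr 2
  ring

theorem integrable_spaceTimeFT_time (u : 𝓢(ℝ × ℝ, ℂ)) (ξ : ℝ) :
    Integrable fun τ => spaceTimeFT (fun p => u p) τ ξ := by
  obtain ⟨C, hC, h⟩ := spaceTimeFT_exists_decay u
  refine (integrable_inv_one_add_abs_sq.const_mul C).mono'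
    ((continuous_spaceTimeFT u).comp (by fun_prop : Continuous fun t : ℝ => (t, ξ))).aestronglyMeasurable
    (Filter.Eventually.of_forall fun τ => (h τ ξ).trans ?_)
  gcongr
  refine mul_le_of_le_one_right (by positivity) (inv_le_one_of_one_le₀ (one_le_pow₀ ?_))
  linarith [abs_nonneg ξ]

theorem fourierIntX_eq_integral_spaceTimeFT (u : 𝓢(ℝ × ℝ, ℂ)) (t ξ : ℝ) :
    fourierIntX (fun p => u p) t ξ = (2 * Real.pi)⁻¹ *
      ∫ τ : ℝ, Complex.exp (Complex.I * t * τ) * spaceTimeFT (fun p => u p) τ ξ := by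
  have h := integral_exp_mul_inversion
    ((continuous_fourierIntX u).comp (by fun_prop : Continuous fun t : ℝ => (t, ξ)))
    (integrable_fourierIntX_time u ξ)
    (by simpa [integral_exp_mul_fourierIntX] using integrable_spaceTimeFT_time u ξ) t
  simpa only [Function.comp_def, integral_exp_mul_fourierIntX] using h

theorem fourierIntX_exists_decay (u : 𝓢(ℝ × ℝ, ℂ)) :
    ∃ C : ℝ, 0 ≤ C ∧ ∀ t ξ : ℝ, ‖fourierIntX (fun p => u p) t ξ‖ ≤ C * ((1 + |ξ|) ^ 2)⁻¹ := by
  obtain ⟨C, hC, h⟩ := spaceTimeFT_exists_decay u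
  refine ⟨(2 * Real.pi)⁻¹ * (C * ∫ x : ℝ, ((1 + |x|) ^ 2)⁻¹),
    mul_nonneg (by positivity) (mul_nonneg hC (integral_nonneg fun x => by positivity)),
    fun t ξ => ?_⟩
  rw [fourierIntX_eq_integral_spaceTimeFT, norm_mul, mul_assoc]
  have hpi : ‖(2 * (Real.pi : ℂ))⁻¹‖ = (2 * Real.pi)⁻¹ := by
    rw [norm_inv, norm_mul, Complex.norm_real, Real.norm_eq_abs, abs_of_pos Real.pi_pos]
    norm_num
  push_cast
  rw [hpi]
  gcongr
  refine (norm_integral_le_mul_integral_inv (A := C * ((1 + |ξ|) ^ 2)⁻¹) fun τ => ?_).trans_eq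
    (by ring)
  rw [norm_mul, norm_exp_I_mul, one_mul]
  exact (h _ _).trans_eq (by ring)

theorem integrable_exp_mul_toLp (W : 𝓢(WithLp 2 (ℝ × ℝ), ℂ)) (t x : ℝ) :
    Integrable fun v : ℝ × ℝ => Complex.exp (Complex.I * t * (2 * Real.pi * v.1 : ℝ)) *
      (Complex.exp (Complex.I * x * (2 * Real.pi * v.2 : ℝ)) * W (WithLp.toLp 2 v)) := by
  have hW : Integrable fun v : ℝ × ℝ => W (WithLp.toLp 2 v) :=
    ((WithLp.volume_preserving_toLp ℝ ℝ).integrable_comp_emb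
      (MeasurableEquiv.toLp 2 (ℝ × ℝ)).measurableEmbedding).mpr W.integrable
  refine hW.norm.mono' ?_ (Filter.Eventually.of_forall fun v => ?_)
  · exact (Continuous.aestronglyMeasurable (by fun_prop)).mul
      ((Continuous.aestronglyMeasurable (by fun_prop)).mul hW.aestronglyMeasurable)
  · rw [norm_mul, norm_mul, norm_exp_I_mul, norm_exp_I_mul, one_mul, one_mul]

theorem fourierInv_plane_eq (W : 𝓢(WithLp 2 (ℝ × ℝ), ℂ)) (t x : ℝ) :
    𝓕⁻ (W : WithLp 2 (ℝ × ℝ) → ℂ) (WithLp.toLp 2 (t, x)) =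
      (2 * Real.pi)⁻¹ * ∫ ξ : ℝ, Complex.exp (Complex.I * x * ξ) *
        ((2 * Real.pi)⁻¹ * ∫ τ : ℝ, Complex.exp (Complex.I * t * τ) *
          W (WithLp.toLp 2 (τ / (2 * Real.pi), ξ / (2 * Real.pi)))) := by
  have hpi : (0 : ℝ) < 2 * Real.pi := by positivity
  have hscale : ∀ F : ℝ → ℂ, ((2 * (Real.pi : ℂ))⁻¹) * ∫ y : ℝ, F y =
      ∫ y : ℝ, F (2 * Real.pi * y) := by
    intro F
    rw [Measure.integral_comp_mul_left F (2 * Real.pi), abs_of_pos (by positivity),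
      Complex.real_smul]
    push_cast
    rfl
  push_cast
  simp_rw [hscale]
  rw [Real.fourierInv_eq', ← (WithLp.volume_preserving_toLp ℝ ℝ).integral_comp
    (MeasurableEquiv.toLp 2 (ℝ × ℝ)).measurableEmbedding]
  have h := integrable_exp_mul_toLp W t x
  have h2 := integral_prod_symm _ (by rwa [Measure.volume_eq_prod] at h)
  rw [← Measure.volume_eq_prod] at h2
  have hlhs : ∀ v : ℝ × ℝ, Complex.exp (↑(2 * Real.pi *
      inner ℝ (WithLp.toLp 2 v) (WithLp.toLp 2 (t, x))) * Complex.I) • W (WithLp.toLp 2 v) =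
      Complex.exp (Complex.I * t * (2 * Real.pi * v.1 : ℝ)) *
      (Complex.exp (Complex.I * x * (2 * Real.pi * v.2 : ℝ)) * W (WithLp.toLp 2 v)) := by
    intro v
    rw [← mul_assoc, ← Complex.exp_add, smul_eq_mul]
    simp only [WithLp.prod_inner_apply, RCLike.inner_apply, conj_trivial]
    congr 2
    push_cast
    ring
  rw [integral_congr_ae (Filter.Eventually.of_forall hlhs), h2]
  refine integral_congr_ae (Filter.Eventually.of_forall fun η => ?_)
  simp only
  rw [← integral_const_mul]
  refine integral_congr_ae (Filter.Eventually.of_forall fun σ => ?_)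
  simp only
  rw [mul_div_cancel_left₀ _ hpi.ne', mul_div_cancel_left₀ _ hpi.ne']
  ring

theorem IsIMultiplier.hasTemperateGrowth_plane {N C₀ : ℝ} {m : ℝ → ℝ} (hm : IsIMultiplier N C₀ m)
    (hN : 1 ≤ N) : Function.HasTemperateGrowth
      fun p : WithLp 2 (ℝ × ℝ) => (m (2 * Real.pi * p.snd) : ℂ) := by
  have hl : Function.HasTemperateGrowth fun p : WithLp 2 (ℝ × ℝ) => 2 * Real.pi * p.snd :=
    ((2 * Real.pi) • ((ContinuousLinearMap.snd ℝ ℝ ℝ).comp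
      (WithLp.prodContinuousLinearEquiv 2 ℝ ℝ ℝ).toContinuousLinearMap)).hasTemperateGrowth
  exact Function.HasTemperateGrowth.comp (Function.Complex.hasTemperateGrowth_ofReal)
    ((hm.hasTemperateGrowth hN).comp hl)

theorem IsIMultiplier.spaceTimeFT_IopST {N C₀ : ℝ} {m : ℝ → ℝ} (hm : IsIMultiplier N C₀ m)
    (hN : 1 ≤ N) (u : 𝓢(ℝ × ℝ, ℂ)) (τ ξ : ℝ) :
    spaceTimeFT (IopST m fun p => u p) τ ξ = m ξ * spaceTimeFT (fun p => u p) τ ξ := by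
  have hg := hm.hasTemperateGrowth_plane hN
  have hpi : (0 : ℝ) < 2 * Real.pi := by positivity
  set W : 𝓢(WithLp 2 (ℝ × ℝ), ℂ) := SchwartzMap.smulLeftCLM ℂ
    (fun p : WithLp 2 (ℝ × ℝ) => (m (2 * Real.pi * p.snd) : ℂ)) (𝓕 (euclideanSchwartz u)) with hW
  have hWe : ∀ τ ξ : ℝ, W (WithLp.toLp 2 (τ / (2 * Real.pi), ξ / (2 * Real.pi))) =
      m ξ * spaceTimeFT (fun p => u p) τ ξ := by
    intro τ ξ
    rw [hW, SchwartzMap.smulLeftCLM_apply_apply hg, spaceTimeFT_schwartz, smul_eq_mul]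
    congr 3
    change 2 * Real.pi * (ξ / (2 * Real.pi)) = ξ
    exact mul_div_cancel₀ _ hpi.ne'
  have hI : (fun p : WithLp 2 (ℝ × ℝ) => IopST m (fun p => u p) (WithLp.ofLp p)) =
      (𝓕⁻ W : 𝓢(WithLp 2 (ℝ × ℝ), ℂ)) := by
    rw [SchwartzMap.fourierInv_coe]
    funext p
    obtain ⟨⟨t, x⟩⟩ := p
    rw [fourierInv_plane_eq]
    simp only [IopST, hWe]
    congr 1
    refine integral_congr_ae (Filter.Eventually.of_forall fun ξ => ?_)
    simp only
    rw [fourierIntX_eq_integral_spaceTimeFT, mul_assoc]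
    congr 1
    rw [mul_left_comm, ← integral_const_mul]
    congr 2
    funext τ
    ring
  rw [spaceTimeFT_eq_fourier, hI, ← SchwartzMap.fourier_coe, ← hWe]
  simp

theorem norm_integral_exp_Icc_le {δ : ℝ} (hδ : 0 < δ) (hδ1 : δ ≤ 1) (θ : ℝ) :
    ‖∫ t in Set.Icc (0:ℝ) δ, Complex.exp (Complex.I * t * θ)‖ ≤ 3 * (1 + |θ|)⁻¹ := by
  have h1 : ‖∫ t in Set.Icc (0:ℝ) δ, Complex.exp (Complex.I * t * θ)‖ ≤ 1 := by
    refine (norm_setIntegral_le_of_norm_le_const (C := 1) (by simp)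
      fun t _ => (norm_exp_I_mul t θ).le).trans ?_
    simp [hδ.le, hδ1]
  have h2 : |θ| * ‖∫ t in Set.Icc (0:ℝ) δ, Complex.exp (Complex.I * t * θ)‖ ≤ 2 := by
    rcases eq_or_ne θ 0 with rfl | hθ
    · simp
    have hc : Complex.I * θ ≠ 0 := mul_ne_zero Complex.I_ne_zero (by exact_mod_cast hθ)
    have he : ∫ t in Set.Icc (0:ℝ) δ, Complex.exp (Complex.I * t * θ) =
        ∫ t in (0:ℝ)..δ, Complex.exp ((Complex.I * θ) * t) := by
      rw [integral_Icc_eq_integral_Ioc, intervalIntegral.integral_of_le hδ.le]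
      refine integral_congr_ae (Filter.Eventually.of_forall fun t => ?_)
      simp only
      congr 1
      ring
    rw [he, integral_exp_mul_complex hc, norm_div, norm_mul, Complex.norm_I, one_mul,
      Complex.norm_real, Real.norm_eq_abs, mul_div_cancel₀ _ (abs_ne_zero.mpr hθ)]
    refine (norm_sub_le _ _).trans ?_
    have e1 := norm_exp_I_mul δ θ
    rw [show Complex.I * θ * δ = Complex.I * δ * θ by ring, e1]
    simp
    norm_num
  rw [← div_eq_mul_inv, le_div_iff₀ (by positivity)]
  linarith

theorem enorm_integral_exp_Icc_le {δ : ℝ} (hδ : 0 < δ) (hδ1 : δ ≤ 1) (θ : ℝ) :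
    ‖∫ t in Set.Icc (0:ℝ) δ, Complex.exp (Complex.I * t * θ)‖ₑ ≤ 3 * decay 1 θ := by
  rw [← ofReal_norm]
  refine (ENNReal.ofReal_le_ofReal (norm_integral_exp_Icc_le hδ hδ1 θ)).trans ?_
  rw [ENNReal.ofReal_mul (by norm_num), decay, Real.rpow_neg_one]
  norm_num

/-- Correlation of a density with a weight. -/
noncomputable def smear (F D : ℝ → ℝ≥0∞) (s : ℝ) : ℝ≥0∞ := ∫⁻ l, F l * D (s + l)

theorem continuous_integral_exp_mul {G : ℝ → ℂ} (hG : Integrable G) :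
    Continuous fun t : ℝ => ∫ l : ℝ, Complex.exp (Complex.I * t * l) * G l := by
  refine continuous_of_dominated (bound := fun l => ‖G l‖) (fun t => ?_) (fun t => ?_) hG.norm
    (Filter.Eventually.of_forall fun l => by fun_prop)
  · exact (Continuous.aestronglyMeasurable (by fun_prop)).mul hG.aestronglyMeasurable
  · exact Filter.Eventually.of_forall fun l => by rw [norm_mul, norm_exp_I_mul, one_mul]

theorem enorm_integral_exp_mul_le_smear {δ : ℝ} {G H : ℝ → ℂ} {D : ℝ → ℝ≥0∞}
    (hG : Integrable G) (hH : Continuous H)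
    (hD : ∀ θ : ℝ, ‖∫ t in Set.Icc (0:ℝ) δ, Complex.exp (Complex.I * t * θ) * H t‖ₑ ≤ D θ)
    (θ : ℝ) :
    ‖∫ t in Set.Icc (0:ℝ) δ, Complex.exp (Complex.I * t * θ) *
      ((∫ l : ℝ, Complex.exp (Complex.I * t * l) * G l) * H t)‖ₑ ≤
      smear (fun l => ‖G l‖ₑ) D θ := by
  have hHi : IntegrableOn H (Set.Icc 0 δ) := hH.continuousOn.integrableOn_Icc
  have h_int : Integrable (Function.uncurry fun t l : ℝ => Complex.exp (Complex.I * t * (θ + l : ℝ)) *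
      (H t * G l)) ((volume.restrict (Set.Icc 0 δ)).prod volume) := by
    refine ((Integrable.mul_prod hHi hG).norm).mono' ?_ (Filter.Eventually.of_forall fun p => ?_)
    · exact (Continuous.aestronglyMeasurable (by fun_prop)).mul
        (Integrable.mul_prod hHi hG).aestronglyMeasurable
    · rw [Function.uncurry_def, norm_mul, norm_exp_I_mul, one_mul]
  have heq : ∫ t in Set.Icc (0:ℝ) δ, Complex.exp (Complex.I * t * θ) *
      ((∫ l : ℝ, Complex.exp (Complex.I * t * l) * G l) * H t) =
      ∫ l : ℝ, G l * ∫ t in Set.Icc (0:ℝ) δ, Complex.exp (Complex.I * t * (θ + l : ℝ)) * H t := by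
    have hsw := integral_integral_swap h_int
    calc _ = ∫ t in Set.Icc (0:ℝ) δ, ∫ l : ℝ,
          Complex.exp (Complex.I * t * (θ + l : ℝ)) * (H t * G l) := by
          refine integral_congr_ae (Filter.Eventually.of_forall fun t => ?_)
          simp only
          rw [← mul_assoc, mul_right_comm, ← integral_const_mul]
          refine integral_congr_ae (Filter.Eventually.of_forall fun l => ?_)
          simp only
          rw [show Complex.I * t * (θ + l : ℝ) = Complex.I * t * θ + Complex.I * t * l by
            push_cast; ring, Complex.exp_add]
          ring
      _ = _ := hsw
      _ = _ := by
          refine integral_congr_ae (Filter.Eventually.of_forall fun l => ?_)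
          simp only
          rw [← integral_const_mul]
          refine integral_congr_ae (Filter.Eventually.of_forall fun t => ?_)
          simp only
          ring
  rw [heq]
  refine (enorm_integral_le_lintegral_enorm _).trans (lintegral_mono fun l => ?_)
  simp only
  rw [enorm_mul]
  gcongr
  exact hD _

theorem measurable_smear {W : Type*} [MeasurableSpace W] {F D : W → ℝ → ℝ≥0∞}
    (hF : Measurable (Function.uncurry F)) (hD : Measurable (Function.uncurry D)) :
    Measurable (Function.uncurry fun w s => smear (F w) (D w) s) := by
  refine Measurable.lintegral_prod_right' (f := fun q : (W × ℝ) × ℝ =>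
    F q.1.1 q.2 * D q.1.1 (q.1.2 + q.2)) ?_
  exact (hF.comp (by fun_prop : Measurable fun q : (W × ℝ) × ℝ => (q.1.1, q.2))).mul
    (hD.comp (by fun_prop : Measurable fun q : (W × ℝ) × ℝ => (q.1.1, q.1.2 + q.2)))

theorem lintegral_mul_smear_le {W : Type*} [MeasureSpace W] [SFinite (volume : Measure W)]
    {A : W → ℝ≥0∞} {F D : W → ℝ → ℝ≥0∞} {a : ℝ → ℝ≥0∞} {K R : ℝ≥0∞} (hA : Measurable A)
    (hF : Measurable (Function.uncurry F)) (hD : Measurable (Function.uncurry D))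
    (ha : Measurable a) (h : ∀ l s, ∫⁻ w, A w * F w l * D w s ≤ K * a l * R) (s : ℝ) :
    ∫⁻ w, A w * smear (F w) (D w) s ≤ K * ((∫⁻ l, a l) * R) := by
  have hm : Measurable (Function.uncurry fun w l => A w * F w l * D w (s + l)) :=
    ((hA.comp measurable_fst).mul hF).mul
      (hD.comp (by fun_prop : Measurable fun q : W × ℝ => (q.1, s + q.2)))
  calc ∫⁻ w, A w * smear (F w) (D w) s = ∫⁻ w, ∫⁻ l, A w * F w l * D w (s + l) := by
        refine lintegral_congr fun w => ?_
        rw [smear, ← lintegral_const_mul]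
        · simp only [mul_assoc]
        · exact (hF.comp measurable_prodMk_left).mul
            (hD.comp (by fun_prop : Measurable fun l : ℝ => (w, s + l)))
    _ = ∫⁻ l, ∫⁻ w, A w * F w l * D w (s + l) := lintegral_lintegral_swap hm.aemeasurable
    _ ≤ ∫⁻ l, K * a l * R := lintegral_mono fun l => h l _
    _ = K * ((∫⁻ l, a l) * R) := by
        rw [lintegral_mul_const _ (ha.const_mul K), lintegral_const_mul _ ha, mul_assoc]

theorem lintegral_mul_smear_six_le {W : Type*} [MeasureSpace W] [SFinite (volume : Measure W)]
    {A : W → ℝ≥0∞} {F₁ F₂ F₃ F₄ F₅ F₆ D : W → ℝ → ℝ≥0∞} {a₁ a₂ a₃ a₄ a₅ a₆ : ℝ → ℝ≥0∞} {K : ℝ≥0∞}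
    (hA : Measurable A)
    (hF₁ : Measurable (Function.uncurry F₁)) (hF₂ : Measurable (Function.uncurry F₂))
    (hF₃ : Measurable (Function.uncurry F₃)) (hF₄ : Measurable (Function.uncurry F₄))
    (hF₅ : Measurable (Function.uncurry F₅)) (hF₆ : Measurable (Function.uncurry F₆))
    (hD : Measurable (Function.uncurry D))
    (ha₁ : Measurable a₁) (ha₂ : Measurable a₂) (ha₃ : Measurable a₃)
    (ha₄ : Measurable a₄) (ha₅ : Measurable a₅) (ha₆ : Measurable a₆)
    (h : ∀ l₁ l₂ l₃ l₄ l₅ l₆ s, ∫⁻ w, A w * F₁ w l₁ * F₂ w l₂ * F₃ w l₃ * F₄ w l₄ * F₅ w l₅ *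
      F₆ w l₆ * D w s ≤ K * a₁ l₁ * a₂ l₂ * a₃ l₃ * a₄ l₄ * a₅ l₅ * a₆ l₆) (s : ℝ) :
    ∫⁻ w, A w * smear (F₁ w) (smear (F₂ w) (smear (F₃ w) (smear (F₄ w) (smear (F₅ w)
      (smear (F₆ w) (D w)))))) s ≤
      K * ((∫⁻ l, a₁ l) * ((∫⁻ l, a₂ l) * ((∫⁻ l, a₃ l) * ((∫⁻ l, a₄ l) * ((∫⁻ l, a₅ l) *
        ((∫⁻ l, a₆ l) * 1)))))) := by
  have hs {F : W → ℝ → ℝ≥0∞} (hF : Measurable (Function.uncurry F)) (l : ℝ) :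
      Measurable fun w => F w l := hF.comp measurable_prodMk_right
  have hD₆ := measurable_smear hF₆ hD
  have hD₅ := measurable_smear hF₅ hD₆
  have hD₄ := measurable_smear hF₄ hD₅
  have hD₃ := measurable_smear hF₃ hD₄
  have hD₂ := measurable_smear hF₂ hD₃
  refine lintegral_mul_smear_le hA hF₁ hD₂ ha₁ (fun l₁ => ?_) s
  have hA₁ := hA.mul (hs hF₁ l₁)
  refine lintegral_mul_smear_le hA₁ hF₂ hD₃ ha₂ (fun l₂ => ?_)
  have hA₂ := hA₁.mul (hs hF₂ l₂)
  refine lintegral_mul_smear_le hA₂ hF₃ hD₄ ha₃ (fun l₃ => ?_)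
  have hA₃ := hA₂.mul (hs hF₃ l₃)
  refine lintegral_mul_smear_le hA₃ hF₄ hD₅ ha₄ (fun l₄ => ?_)
  have hA₄ := hA₃.mul (hs hF₄ l₄)
  refine lintegral_mul_smear_le hA₄ hF₅ hD₆ ha₅ (fun l₅ => ?_)
  have hA₅ := hA₄.mul (hs hF₅ l₅)
  refine lintegral_mul_smear_le hA₅ hF₆ hD ha₆ (fun l₆ s => ?_)
  rw [mul_one]
  exact h l₁ l₂ l₃ l₄ l₅ l₆ s

theorem enorm_integral_mul_six_le {δ : ℝ} (hδ : 0 < δ) (hδ1 : δ ≤ 1)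
    {G₁ G₂ G₃ G₄ G₅ G₆ : ℝ → ℂ} (h₁ : Integrable G₁) (h₂ : Integrable G₂) (h₃ : Integrable G₃)
    (h₄ : Integrable G₄) (h₅ : Integrable G₅) (h₆ : Integrable G₆) (c : ℝ) :
    ‖∫ t in Set.Icc (0:ℝ) δ, (∫ l : ℝ, Complex.exp (Complex.I * t * l) * G₁ l) *
      ((∫ l : ℝ, Complex.exp (Complex.I * t * l) * G₂ l) *
      ((∫ l : ℝ, Complex.exp (Complex.I * t * l) * G₃ l) *
      ((∫ l : ℝ, Complex.exp (Complex.I * t * l) * G₄ l) *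
      ((∫ l : ℝ, Complex.exp (Complex.I * t * l) * G₅ l) *
      ((∫ l : ℝ, Complex.exp (Complex.I * t * l) * G₆ l) *
        Complex.exp (Complex.I * t * c))))))‖ₑ ≤
    smear (fun l => ‖G₁ l‖ₑ) (smear (fun l => ‖G₂ l‖ₑ) (smear (fun l => ‖G₃ l‖ₑ)
      (smear (fun l => ‖G₄ l‖ₑ) (smear (fun l => ‖G₅ l‖ₑ) (smear (fun l => ‖G₆ l‖ₑ)
      (fun s => 3 * decay 1 (s + c))))))) 0 := by
  have c₇ : Continuous fun t : ℝ => Complex.exp (Complex.I * t * c) := by fun_prop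
  have c₆ := (continuous_integral_exp_mul h₆).mul c₇
  have c₅ := (continuous_integral_exp_mul h₅).mul c₆
  have c₄ := (continuous_integral_exp_mul h₄).mul c₅
  have c₃ := (continuous_integral_exp_mul h₃).mul c₄
  have c₂ := (continuous_integral_exp_mul h₂).mul c₃
  have hbase : ∀ θ : ℝ, ‖∫ t in Set.Icc (0:ℝ) δ, Complex.exp (Complex.I * t * θ) *
      Complex.exp (Complex.I * t * c)‖ₑ ≤ 3 * decay 1 (θ + c) := by
    intro θ
    convert enorm_integral_exp_Icc_le hδ hδ1 (θ + c) using 5 with t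
    rw [← Complex.exp_add]
    push_cast
    ring_nf
  have h := enorm_integral_exp_mul_le_smear h₁ c₂ (enorm_integral_exp_mul_le_smear h₂ c₃
    (enorm_integral_exp_mul_le_smear h₃ c₄ (enorm_integral_exp_mul_le_smear h₄ c₅
    (enorm_integral_exp_mul_le_smear h₅ c₆ (enorm_integral_exp_mul_le_smear h₆ c₇
    hbase))))) 0
  simpa only [Complex.ofReal_zero, mul_zero, Complex.exp_zero, one_mul, Pi.mul_apply] using h

/-- The space-time Fourier transform in coordinates centred on the curve `τ = -ξ⁴`. -/
noncomputable def profile (u : 𝓢(ℝ × ℝ, ℂ)) (ξ l : ℝ) : ℂ :=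
  (2 * Real.pi)⁻¹ * spaceTimeFT (fun p => u p) (l - ξ ^ 4) ξ

theorem continuous_profile (u : 𝓢(ℝ × ℝ, ℂ)) : Continuous (Function.uncurry (profile u)) := by
  have h : Continuous fun q : ℝ × ℝ => (q.2 - q.1 ^ 4, q.1) := by fun_prop
  have h2 := (continuous_spaceTimeFT u).comp h
  simp only [Function.comp_def] at h2
  simp only [Function.uncurry_def, profile]
  exact continuous_const.mul h2

theorem integrable_profile (u : 𝓢(ℝ × ℝ, ℂ)) (ξ : ℝ) : Integrable (profile u ξ) :=
  ((integrable_spaceTimeFT_time u ξ).comp_sub_right (ξ ^ 4)).const_mul _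

theorem fourierIntX_eq_profile (u : 𝓢(ℝ × ℝ, ℂ)) (t ξ : ℝ) :
    fourierIntX (fun p => u p) t ξ = Complex.exp (Complex.I * t * (-(ξ ^ 4) : ℝ)) *
      ∫ l : ℝ, Complex.exp (Complex.I * t * l) * profile u ξ l := by
  rw [fourierIntX_eq_integral_spaceTimeFT, ← integral_sub_right_eq_self _ (ξ ^ 4),
    ← integral_const_mul, ← integral_const_mul]
  refine integral_congr_ae (Filter.Eventually.of_forall fun l => ?_)
  simp only [profile]
  rw [← mul_assoc, ← mul_assoc, ← Complex.exp_add, show Complex.I * t * (-(ξ ^ 4) : ℝ) +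
    Complex.I * t * l = Complex.I * t * (l - ξ ^ 4 : ℝ) by push_cast; ring]
  ring

theorem conj_exp_I_mul (t θ : ℝ) : (starRingEnd ℂ) (Complex.exp (Complex.I * t * θ)) =
    Complex.exp (Complex.I * t * (-θ : ℝ)) := by
  rw [← Complex.exp_conj]
  simp

theorem conj_fourierIntX_eq_profile (u : 𝓢(ℝ × ℝ, ℂ)) (t ξ : ℝ) :
    (starRingEnd ℂ) (fourierIntX (fun p => u p) t (-ξ)) =
      Complex.exp (Complex.I * t * (ξ ^ 4 : ℝ)) *
      ∫ l : ℝ, Complex.exp (Complex.I * t * l) * (starRingEnd ℂ) (profile u (-ξ) (-l)) := by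
  rw [fourierIntX_eq_profile, map_mul, conj_exp_I_mul, neg_neg, Even.neg_pow (by decide),
    ← integral_conj, ← integral_neg_eq_self]
  simp only [map_mul, conj_exp_I_mul, neg_neg]

theorem integrable_conj_profile (u : 𝓢(ℝ × ℝ, ℂ)) (ξ : ℝ) :
    Integrable fun l => (starRingEnd ℂ) (profile u ξ (-l)) :=
  (Complex.conjLIE.toContinuousLinearEquiv.toContinuousLinearMap.integrable_comp
    (integrable_profile u ξ).comp_neg)

/-- The `m`-weighted `L²` mass of a profile on a fixed level of the modulation. -/
noncomputable def profileMass (m : ℝ → ℝ) (u : 𝓢(ℝ × ℝ, ℂ)) (l : ℝ) : ℝ≥0∞ :=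
  (∫⁻ x, (ENNReal.ofReal (m x) * ‖profile u x l‖ₑ) ^ 2) ^ (1 / 2 : ℝ)

theorem measurable_lintegral_profile {m : ℝ → ℝ} (hm : Measurable m) (u : 𝓢(ℝ × ℝ, ℂ)) :
    Measurable fun l => ∫⁻ x, (ENNReal.ofReal (m x) * ‖profile u x l‖ₑ) ^ 2 := by
  have hp : Measurable fun q : ℝ × ℝ => ‖profile u q.1 q.2‖ₑ :=
    (continuous_profile u).measurable.enorm
  refine Measurable.lintegral_prod_right' (f := fun q : ℝ × ℝ =>
    (ENNReal.ofReal (m q.2) * ‖profile u q.2 q.1‖ₑ) ^ 2) ?_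
  have hp' := hp.comp measurable_swap
  exact ((hm.comp measurable_snd).ennreal_ofReal.mul hp').pow_const 2

theorem measurable_profileMass {m : ℝ → ℝ} (hm : Measurable m) (u : 𝓢(ℝ × ℝ, ℂ)) :
    Measurable (profileMass m u) :=
  (measurable_lintegral_profile hm u).pow_const _

theorem IsIMultiplier.lintegral_weight_le_Xnorm_sq {N C₀ : ℝ} {m : ℝ → ℝ}
    (hm : IsIMultiplier N C₀ m) (hN : 1 ≤ N) (b : ℝ) (u : 𝓢(ℝ × ℝ, ℂ)) :
    ∫⁻ l : ℝ, ENNReal.ofReal ((1 + l ^ 2) ^ b) *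
      ∫⁻ x, (ENNReal.ofReal (m x) * ‖profile u x l‖ₑ) ^ 2 ≤
      (Xnorm 0 b (IopST m fun p => u p)) ^ (2 : ℝ) := by
  have hmm : Measurable m := hm.1.continuous.measurable
  have hw : ∀ s : ℝ, Measurable fun l : ℝ => ENNReal.ofReal ((1 + l ^ 2) ^ s) := fun s =>
    ((measurable_const.add (measurable_id.pow_const 2)).pow_const s).ennreal_ofReal
  have hp : Measurable fun q : ℝ × ℝ => ‖profile u q.1 q.2‖ₑ :=
    (continuous_profile u).measurable.enorm
  have hV : Measurable fun q : ℝ × ℝ => ‖spaceTimeFT (fun p => u p) q.1 q.2‖ₑ :=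
    (continuous_spaceTimeFT u).measurable.enorm
  have hX : (Xnorm 0 b (IopST m fun p => u p)) ^ (2 : ℝ) =
      ∫⁻ q : ℝ × ℝ, ENNReal.ofReal ((1 + (q.1 + q.2 ^ 4) ^ 2) ^ b) *
        (ENNReal.ofReal (m q.2) * ‖spaceTimeFT (fun p => u p) q.1 q.2‖ₑ) ^ 2 := by
    rw [Xnorm, eLpNorm_eq_lintegral_rpow_enorm_toReal (by norm_num) (by norm_num), ← ENNReal.rpow_mul]
    norm_num
    refine lintegral_congr fun q => ?_
    have h0 : 0 ≤ 1 + (q.1 + q.2 ^ 4) ^ 2 := by positivity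
    rw [hm.spaceTimeFT_IopST hN, enorm_mul, ← ofReal_norm (m q.2 : ℂ), Complex.norm_real, Real.norm_eq_abs,
      abs_of_nonneg (hm.2.2.1 _).1, mul_pow]
    congr 1
    rw [← ofReal_norm, Complex.norm_real, Real.norm_eq_abs,
      abs_of_nonneg (by positivity), ← ENNReal.ofReal_pow (by positivity), ← Real.rpow_natCast,
      ← Real.rpow_mul h0]
    norm_num
  rw [hX, Measure.volume_eq_prod, lintegral_prod_symm]
  swap
  · refine Measurable.aemeasurable ?_
    exact ((hw b).comp (by fun_prop : Measurable fun q : ℝ × ℝ => q.1 + q.2 ^ 4)).mul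
      (((hmm.comp measurable_snd).ennreal_ofReal.mul hV).pow_const 2)
  calc ∫⁻ l : ℝ, ENNReal.ofReal ((1 + l ^ 2) ^ b) *
      ∫⁻ x, (ENNReal.ofReal (m x) * ‖profile u x l‖ₑ) ^ 2
      = ∫⁻ l : ℝ, ∫⁻ x, ENNReal.ofReal ((1 + l ^ 2) ^ b) *
        (ENNReal.ofReal (m x) * ‖profile u x l‖ₑ) ^ 2 := by
        refine lintegral_congr fun l => ?_
        rw [lintegral_const_mul' _ _ ENNReal.ofReal_ne_top]
    _ = ∫⁻ x, ∫⁻ l : ℝ, ENNReal.ofReal ((1 + l ^ 2) ^ b) *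
        (ENNReal.ofReal (m x) * ‖profile u x l‖ₑ) ^ 2 := by
        refine lintegral_lintegral_swap (Measurable.aemeasurable ?_)
        have hp' := hp.comp measurable_swap
        exact ((hw b).comp measurable_fst).mul
          (((hmm.comp measurable_snd).ennreal_ofReal.mul hp').pow_const 2)
    _ ≤ _ := by
        refine lintegral_mono fun x => ?_
        simp only
        rw [← lintegral_add_right_eq_self _ (x ^ 4)]
        refine lintegral_mono fun l => ?_
        gcongr
        simp only [profile]
        rw [enorm_mul, add_sub_cancel_right]
        refine mul_le_of_le_one_left zero_le ?_
        rw [← ofReal_norm]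
        refine ENNReal.ofReal_le_one.mpr ?_
        rw [Complex.norm_real, Real.norm_eq_abs, abs_of_nonneg (by positivity)]
        exact inv_le_one_of_one_le₀ (by linarith [Real.pi_gt_three])

theorem exists_lintegral_profileMass_le {b : ℝ} (hb : 1 / 2 < b) :
    ∃ K : ℝ, 0 < K ∧ ∀ N C₀ : ℝ, 1 ≤ N → ∀ m, IsIMultiplier N C₀ m → ∀ u : 𝓢(ℝ × ℝ, ℂ),
      ∫⁻ l, profileMass m u l ≤ ENNReal.ofReal K * Xnorm 0 b (IopST m fun p => u p) := by
  have h_int : Integrable fun l : ℝ => (1 + l ^ 2) ^ (-b) := by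
    have h := integrable_rpow_neg_one_add_norm_sq (E := ℝ) (μ := volume) (r := 2 * b)
      (by simp; linarith)
    simpa [neg_div] using h
  have hfin : (∫⁻ l : ℝ, ENNReal.ofReal ((1 + l ^ 2) ^ (-b))) ^ (1 / 2 : ℝ) ≠ ⊤ :=
    ENNReal.rpow_ne_top_of_nonneg (by norm_num) h_int.lintegral_lt_top.ne
  refine ⟨((∫⁻ l : ℝ, ENNReal.ofReal ((1 + l ^ 2) ^ (-b))) ^ (1 / 2 : ℝ)).toReal + 1,
    by positivity, fun N C₀ hN m hm u => ?_⟩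
  have hmm : Measurable m := hm.1.continuous.measurable
  have hw : ∀ s : ℝ, Measurable fun l : ℝ => ENNReal.ofReal ((1 + l ^ 2) ^ s) := fun s =>
    ((measurable_const.add (measurable_id.pow_const 2)).pow_const s).ennreal_ofReal
  have hA := measurable_lintegral_profile hmm u
  calc ∫⁻ l, profileMass m u l
      = ∫⁻ l : ℝ, (ENNReal.ofReal ((1 + l ^ 2) ^ (-b))) ^ (1 / 2 : ℝ) *
        (ENNReal.ofReal ((1 + l ^ 2) ^ b) *
          ∫⁻ x, (ENNReal.ofReal (m x) * ‖profile u x l‖ₑ) ^ 2) ^ (1 / 2 : ℝ) := by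
        refine lintegral_congr fun l => ?_
        have h0 : 0 < 1 + l ^ 2 := by positivity
        rw [← ENNReal.mul_rpow_of_nonneg _ _ (by norm_num), ← mul_assoc,
          ← ENNReal.ofReal_mul (by positivity), ← Real.rpow_add h0, neg_add_cancel, Real.rpow_zero,
          ENNReal.ofReal_one, one_mul, profileMass]
    _ ≤ (∫⁻ l : ℝ, ENNReal.ofReal ((1 + l ^ 2) ^ (-b))) ^ (1 / 2 : ℝ) *
        (∫⁻ l : ℝ, ENNReal.ofReal ((1 + l ^ 2) ^ b) *
          ∫⁻ x, (ENNReal.ofReal (m x) * ‖profile u x l‖ₑ) ^ 2) ^ (1 / 2 : ℝ) :=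
        ENNReal.lintegral_mul_norm_pow_le (hw _).aemeasurable ((hw _).mul hA).aemeasurable
          (by norm_num) (by norm_num) (by norm_num)
    _ ≤ (∫⁻ l : ℝ, ENNReal.ofReal ((1 + l ^ 2) ^ (-b))) ^ (1 / 2 : ℝ) *
        ((Xnorm 0 b (IopST m fun p => u p)) ^ (2 : ℝ)) ^ (1 / 2 : ℝ) := by
        gcongr
        exact hm.lintegral_weight_le_Xnorm_sq hN b u
    _ ≤ _ := by
        rw [← ENNReal.rpow_mul]
        norm_num
        gcongr
        rw [ENNReal.ofReal_add ENNReal.toReal_nonneg zero_le_one]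
        refine le_trans ?_ le_self_add
        rw [← ENNReal.ofReal_toReal hfin]
        norm_num

theorem enorm_conj (z : ℂ) : ‖(starRingEnd ℂ) z‖ₑ = ‖z‖ₑ := by
  rw [← ofReal_norm, ← ofReal_norm, RCLike.norm_conj]

theorem enorm_time_integral_le {δ : ℝ} (hδ : 0 < δ) (hδ1 : δ ≤ 1)
    (u₁ u₂ u₃ u₄ u₅ u₆ : 𝓢(ℝ × ℝ, ℂ)) (c : ℂ) (x₁ x₂ x₃ x₄ x₅ x₆ : ℝ) :
    ‖∫ t in Set.Icc (0:ℝ) δ, c * fourierIntX (fun p => u₁ p) t x₁ *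
      (starRingEnd ℂ) (fourierIntX (fun p => u₂ p) t (-x₂)) *
      fourierIntX (fun p => u₃ p) t x₃ *
      (starRingEnd ℂ) (fourierIntX (fun p => u₄ p) t (-x₄)) *
      fourierIntX (fun p => u₅ p) t x₅ *
      (starRingEnd ℂ) (fourierIntX (fun p => u₆ p) t (-x₆))‖ₑ ≤
    ‖c‖ₑ * smear (fun l => ‖profile u₁ x₁ l‖ₑ) (smear (fun l => ‖profile u₂ (-x₂) (-l)‖ₑ)
      (smear (fun l => ‖profile u₃ x₃ l‖ₑ) (smear (fun l => ‖profile u₄ (-x₄) (-l)‖ₑ)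
      (smear (fun l => ‖profile u₅ x₅ l‖ₑ) (smear (fun l => ‖profile u₆ (-x₆) (-l)‖ₑ)
      (fun s => 3 * decay 1 (s - (x₁ ^ 4 - x₂ ^ 4 + x₃ ^ 4 - x₄ ^ 4 + x₅ ^ 4 - x₆ ^ 4)))))))) 0 := by
  have h := enorm_integral_mul_six_le hδ hδ1 (integrable_profile u₁ x₁)
    (integrable_conj_profile u₂ (-x₂)) (integrable_profile u₃ x₃)
    (integrable_conj_profile u₄ (-x₄)) (integrable_profile u₅ x₅)
    (integrable_conj_profile u₆ (-x₆)) (-(x₁ ^ 4 - x₂ ^ 4 + x₃ ^ 4 - x₄ ^ 4 + x₅ ^ 4 - x₆ ^ 4))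
  simp only [enorm_conj, ← sub_eq_add_neg] at h
  refine le_trans (le_of_eq ?_) (mul_le_mul_right h ‖c‖ₑ)
  rw [← enorm_mul, ← integral_const_mul]
  congr 1
  refine integral_congr_ae (Filter.Eventually.of_forall fun t => ?_)
  simp only
  rw [fourierIntX_eq_profile u₁, fourierIntX_eq_profile u₃, fourierIntX_eq_profile u₅,
    conj_fourierIntX_eq_profile u₂, conj_fourierIntX_eq_profile u₄, conj_fourierIntX_eq_profile u₆]
  rw [show Complex.I * t * (-(x₁ ^ 4 - x₂ ^ 4 + x₃ ^ 4 - x₄ ^ 4 + x₅ ^ 4 - x₆ ^ 4) : ℝ) =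
    Complex.I * t * (-(x₁ ^ 4) : ℝ) + Complex.I * t * (x₂ ^ 4 : ℝ) +
    Complex.I * t * (-(x₃ ^ 4) : ℝ) + Complex.I * t * (x₄ ^ 4 : ℝ) +
    Complex.I * t * (-(x₅ ^ 4) : ℝ) + Complex.I * t * (x₆ ^ 4 : ℝ) by push_cast; ring]
  simp only [Complex.exp_add]
  ring

theorem IsIMultiplier.exists_abs_sigma4_le {N C₀ : ℝ} {m : ℝ → ℝ} (hm : IsIMultiplier N C₀ m)
    (hN : 1 ≤ N) (hC : 0 ≤ C₀) : ∃ M : ℝ, 0 ≤ M ∧ ∀ a b c : ℝ, |sigma4 m a b c (-a - b - c)| ≤ M := by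
  have hN0 : 0 < N := by linarith
  refine ⟨16 * C₀ / (N * N ^ 3), by positivity, fun a b c => ?_⟩
  by_cases h : N ≤ |a| ∨ N ≤ |b| ∨ N ≤ |c| ∨ N ≤ |-a - b - c|
  · exact hm.abs_sigma4_le hN0 hC le_rfl (by ring) h
  · push Not at h
    rw [hm.sigma4_eq_zero h.1.le h.2.1.le h.2.2.1.le h.2.2.2.le, abs_zero]
    positivity

theorem measurable_fourierIntX (u : 𝓢(ℝ × ℝ, ℂ)) {α : Type*} [MeasurableSpace α] {f g : α → ℝ}
    (hf : Measurable f) (hg : Measurable g) :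
    Measurable fun a => fourierIntX (fun p => u p) (f a) (g a) := by
  have h := (continuous_fourierIntX u).measurable.comp (hf.prodMk hg)
  simpa only [Function.comp_def] using h

theorem IsIMultiplier.integrable_six_form {N C₀ : ℝ} {m : ℝ → ℝ} (hm : IsIMultiplier N C₀ m)
    (hN : 1 ≤ N) (hC : 0 ≤ C₀) (δ : ℝ) (u₁ u₂ u₃ u₄ u₅ u₆ : 𝓢(ℝ × ℝ, ℂ)) :
    Integrable (Function.uncurry fun (t : ℝ) (w : ℝ × ℝ × ℝ × ℝ × ℝ) =>
      (sigma4 m w.1 w.2.1 w.2.2.1 (-w.1 - w.2.1 - w.2.2.1) : ℂ) *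
        fourierIntX (fun p => u₁ p) t w.1 *
        (starRingEnd ℂ) (fourierIntX (fun p => u₂ p) t (-w.2.1)) *
        fourierIntX (fun p => u₃ p) t w.2.2.1 *
        (starRingEnd ℂ) (fourierIntX (fun p => u₄ p) t (-w.2.2.2.1)) *
        fourierIntX (fun p => u₅ p) t w.2.2.2.2 *
        (starRingEnd ℂ) (fourierIntX (fun p => u₆ p) t
          (w.1 + w.2.1 + w.2.2.1 + w.2.2.2.1 + w.2.2.2.2)))
      ((volume.restrict (Set.Icc 0 δ)).prod volume) := by
  obtain ⟨M, hM, hσ⟩ := hm.exists_abs_sigma4_le hN hC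
  obtain ⟨C₁, hC₁, h₁⟩ := fourierIntX_exists_decay u₁
  obtain ⟨C₂, hC₂, h₂⟩ := fourierIntX_exists_decay u₂
  obtain ⟨C₃, hC₃, h₃⟩ := fourierIntX_exists_decay u₃
  obtain ⟨C₄, hC₄, h₄⟩ := fourierIntX_exists_decay u₄
  obtain ⟨C₅, hC₅, h₅⟩ := fourierIntX_exists_decay u₅
  obtain ⟨C₆, hC₆, h₆⟩ := fourierIntX_exists_decay u₆
  have hq := integrable_inv_one_add_abs_sq
  have hq₅ := (hq.const_mul C₁).mul_prod ((hq.const_mul C₂).mul_prod ((hq.const_mul C₃).mul_prod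
    ((hq.const_mul C₄).mul_prod (hq.const_mul C₅))))
  have hone : Integrable (fun _ : ℝ => M * C₆) (volume.restrict (Set.Icc 0 δ)) :=
    integrable_const _
  refine (hone.mul_prod hq₅).mono' (Measurable.aestronglyMeasurable ?_)
    (Filter.Eventually.of_forall fun p => ?_)
  · have ha : Measurable fun p : ℝ × ℝ × ℝ × ℝ × ℝ × ℝ =>
        (p.2.1, p.2.2.1, p.2.2.2.1, -p.2.1 - p.2.2.1 - p.2.2.2.1) := by fun_prop
    have hs := (measurable_sigma4 hm.1.continuous.measurable).comp ha
    simp only [Function.comp_def] at hs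
    have hconj : Measurable (starRingEnd ℂ) := Complex.continuous_conj.measurable
    simp only [Function.uncurry_def]
    refine Measurable.mul (Measurable.mul (Measurable.mul (Measurable.mul (Measurable.mul
      (Measurable.mul (Complex.measurable_ofReal.comp hs) ?_) (hconj.comp ?_)) ?_)
      (hconj.comp ?_)) ?_) (hconj.comp ?_) <;>
    exact measurable_fourierIntX _ (by fun_prop) (by fun_prop)
  · obtain ⟨t, x₁, x₂, x₃, x₄, x₅⟩ := p
    simp only [Function.uncurry_apply_pair, norm_mul, RCLike.norm_conj, Complex.norm_real,
      Real.norm_eq_abs]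
    have g₂ := h₂ t (-x₂)
    have g₄ := h₄ t (-x₄)
    rw [abs_neg] at g₂ g₄
    have g₆ : ‖fourierIntX (fun p => u₆ p) t (x₁ + x₂ + x₃ + x₄ + x₅)‖ ≤ C₆ := by
      refine (h₆ _ _).trans (mul_le_of_le_one_right hC₆ (inv_le_one_of_one_le₀ (one_le_pow₀ ?_)))
      linarith [abs_nonneg (x₁ + x₂ + x₃ + x₄ + x₅)]
    calc _ ≤ M * (C₁ * ((1 + |x₁|) ^ 2)⁻¹) * (C₂ * ((1 + |x₂|) ^ 2)⁻¹) *
        (C₃ * ((1 + |x₃|) ^ 2)⁻¹) * (C₄ * ((1 + |x₄|) ^ 2)⁻¹) * (C₅ * ((1 + |x₅|) ^ 2)⁻¹) * C₆ := by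
          gcongr
          · exact hσ _ _ _
          · exact h₁ _ _
          · exact h₃ _ _
          · exact h₅ _ _
      _ = _ := by ring

theorem IsIMultiplier.lintegral_profile_neg {N C₀ : ℝ} {m : ℝ → ℝ} (hm : IsIMultiplier N C₀ m)
    (u : 𝓢(ℝ × ℝ, ℂ)) (l : ℝ) :
    (∫⁻ x, (ENNReal.ofReal (m x) * ‖profile u (-x) l‖ₑ) ^ 2) ^ (1 / 2 : ℝ) = profileMass m u l := by
  rw [profileMass, ← lintegral_neg_eq_self]
  simp only [neg_neg, hm.2.1]

theorem lintegral_profileMass_neg (m : ℝ → ℝ) (u : 𝓢(ℝ × ℝ, ℂ)) :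
    ∫⁻ l, profileMass m u (-l) = ∫⁻ l, profileMass m u l :=
  lintegral_neg_eq_self _

theorem measurable_enorm_profile (u : 𝓢(ℝ × ℝ, ℂ)) {α : Type*} [MeasurableSpace α] {f g : α → ℝ}
    (hf : Measurable f) (hg : Measurable g) : Measurable fun a => ‖profile u (f a) (g a)‖ₑ := by
  have h := (continuous_profile u).measurable.enorm.comp (hf.prodMk hg)
  simpa only [Function.comp_def, Function.uncurry_apply_pair] using h

/-- Bound of the nested correlation form of the six-linear expression by modulation masses. -/
theorem exists_lintegral_sigma4_smear_le {C₀ : ℝ} (hC₀ : 0 ≤ C₀) : ∃ K : ℝ, 0 < K ∧ ∀ N : ℝ, 1 ≤ N →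
    ∀ m : ℝ → ℝ, IsIMultiplier N C₀ m → ∀ u₁ u₂ u₃ u₄ u₅ u₆ : 𝓢(ℝ × ℝ, ℂ),
    ∫⁻ w : ℝ × ℝ × ℝ × ℝ × ℝ,
      ENNReal.ofReal |sigma4 m w.1 w.2.1 w.2.2.1 (-w.1 - w.2.1 - w.2.2.1)| *
      smear (fun l => ‖profile u₁ w.1 l‖ₑ) (smear (fun l => ‖profile u₂ (-w.2.1) (-l)‖ₑ)
      (smear (fun l => ‖profile u₃ w.2.2.1 l‖ₑ) (smear (fun l => ‖profile u₄ (-w.2.2.2.1) (-l)‖ₑ)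
      (smear (fun l => ‖profile u₅ w.2.2.2.2 l‖ₑ) (smear (fun l => ‖profile u₆
        (- -(w.1 + w.2.1 + w.2.2.1 + w.2.2.2.1 + w.2.2.2.2)) (-l)‖ₑ)
      (fun s => 3 * decay 1 (s - (w.1 ^ 4 - w.2.1 ^ 4 + w.2.2.1 ^ 4 - w.2.2.2.1 ^ 4 +
        w.2.2.2.2 ^ 4 - (-(w.1 + w.2.1 + w.2.2.1 + w.2.2.2.1 + w.2.2.2.2)) ^ 4)))))))) 0 ≤
    ENNReal.ofReal (K * N ^ (-(3 : ℝ))) *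
      ((∫⁻ l, profileMass m u₁ l) * ((∫⁻ l, profileMass m u₂ l) * ((∫⁻ l, profileMass m u₃ l) *
      ((∫⁻ l, profileMass m u₄ l) * ((∫⁻ l, profileMass m u₅ l) *
        ((∫⁻ l, profileMass m u₆ l) * 1)))))) := by
  obtain ⟨K, hK, hform⟩ := exists_sigma4_form_le hC₀
  refine ⟨3 * K, by positivity, fun N hN m hm u₁ u₂ u₃ u₄ u₅ u₆ => ?_⟩
  have hmm : Measurable m := hm.1.continuous.measurable
  have ha : Measurable fun w : ℝ × ℝ × ℝ × ℝ × ℝ =>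
    (w.1, w.2.1, w.2.2.1, -w.1 - w.2.1 - w.2.2.1) := by fun_prop
  have hσ := (measurable_sigma4 hmm).comp ha
  simp only [Function.comp_def] at hσ
  have hA : Measurable fun w : ℝ × ℝ × ℝ × ℝ × ℝ =>
      ENNReal.ofReal |sigma4 m w.1 w.2.1 w.2.2.1 (-w.1 - w.2.1 - w.2.2.1)| :=
    (continuous_abs.measurable.comp hσ).ennreal_ofReal
  have hd : Measurable fun q : (ℝ × ℝ × ℝ × ℝ × ℝ) × ℝ => q.2 - (q.1.1 ^ 4 - q.1.2.1 ^ 4 +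
      q.1.2.2.1 ^ 4 - q.1.2.2.2.1 ^ 4 + q.1.2.2.2.2 ^ 4 -
      (-(q.1.1 + q.1.2.1 + q.1.2.2.1 + q.1.2.2.2.1 + q.1.2.2.2.2)) ^ 4) := by fun_prop
  have hD := ((measurable_decay 1).comp hd).const_mul (3 : ℝ≥0∞)
  simp only [Function.comp_def] at hD
  have hP := fun u => measurable_profileMass hmm u
  have hPn := fun u => (measurable_profileMass hmm u).comp measurable_neg
  simp only [Function.comp_def] at hPn
  have hF₁ : Measurable (Function.uncurry fun (w : ℝ × ℝ × ℝ × ℝ × ℝ) (l : ℝ) =>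
      ‖profile u₁ w.1 l‖ₑ) :=
    measurable_enorm_profile u₁ (f := fun q : (ℝ × ℝ × ℝ × ℝ × ℝ) × ℝ => q.1.1)
      (g := fun q => q.2) (by fun_prop) (by fun_prop)
  have hF₂ : Measurable (Function.uncurry fun (w : ℝ × ℝ × ℝ × ℝ × ℝ) (l : ℝ) =>
      ‖profile u₂ (-w.2.1) (-l)‖ₑ) :=
    measurable_enorm_profile u₂ (f := fun q : (ℝ × ℝ × ℝ × ℝ × ℝ) × ℝ => (-q.1.2.1))
      (g := fun q => (-q.2)) (by fun_prop) (by fun_prop)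
  have hF₃ : Measurable (Function.uncurry fun (w : ℝ × ℝ × ℝ × ℝ × ℝ) (l : ℝ) =>
      ‖profile u₃ w.2.2.1 l‖ₑ) :=
    measurable_enorm_profile u₃ (f := fun q : (ℝ × ℝ × ℝ × ℝ × ℝ) × ℝ => q.1.2.2.1)
      (g := fun q => q.2) (by fun_prop) (by fun_prop)
  have hF₄ : Measurable (Function.uncurry fun (w : ℝ × ℝ × ℝ × ℝ × ℝ) (l : ℝ) =>
      ‖profile u₄ (-w.2.2.2.1) (-l)‖ₑ) :=
    measurable_enorm_profile u₄ (f := fun q : (ℝ × ℝ × ℝ × ℝ × ℝ) × ℝ => (-q.1.2.2.2.1))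
      (g := fun q => (-q.2)) (by fun_prop) (by fun_prop)
  have hF₅ : Measurable (Function.uncurry fun (w : ℝ × ℝ × ℝ × ℝ × ℝ) (l : ℝ) =>
      ‖profile u₅ w.2.2.2.2 l‖ₑ) :=
    measurable_enorm_profile u₅ (f := fun q : (ℝ × ℝ × ℝ × ℝ × ℝ) × ℝ => q.1.2.2.2.2)
      (g := fun q => q.2) (by fun_prop) (by fun_prop)
  have hF₆ : Measurable (Function.uncurry fun (w : ℝ × ℝ × ℝ × ℝ × ℝ) (l : ℝ) =>
      ‖profile u₆ (- -(w.1 + w.2.1 + w.2.2.1 + w.2.2.2.1 + w.2.2.2.2)) (-l)‖ₑ) :=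
    measurable_enorm_profile u₆ (f := fun q : (ℝ × ℝ × ℝ × ℝ × ℝ) × ℝ => (- -(q.1.1 + q.1.2.1 + q.1.2.2.1 + q.1.2.2.2.1 + q.1.2.2.2.2)))
      (g := fun q => (-q.2)) (by fun_prop) (by fun_prop)
  have key := lintegral_mul_smear_six_le (W := ℝ × ℝ × ℝ × ℝ × ℝ)
    (K := ENNReal.ofReal (3 * K * N ^ (-(3 : ℝ)))) hA hF₁ hF₂ hF₃ hF₄ hF₅ hF₆
    (D := fun w s => 3 * decay 1 (s - (w.1 ^ 4 - w.2.1 ^ 4 + w.2.2.1 ^ 4 - w.2.2.2.1 ^ 4 +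
        w.2.2.2.2 ^ 4 - (-(w.1 + w.2.1 + w.2.2.1 + w.2.2.2.1 + w.2.2.2.2)) ^ 4)))
    hD (hP u₁) (hPn u₂) (hP u₃) (hPn u₄) (hP u₅) (hPn u₆) ?_ 0
  · simpa only [lintegral_profileMass_neg] using key
  · intro l₁ l₂ l₃ l₄ l₅ l₆ s
    have h := hform N hN m hm s (fun x => ‖profile u₁ x l₁‖ₑ) (fun x => ‖profile u₂ (-x) (-l₂)‖ₑ)
      (fun x => ‖profile u₃ x l₃‖ₑ) (fun x => ‖profile u₄ (-x) (-l₄)‖ₑ)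
      (fun x => ‖profile u₅ x l₅‖ₑ) (fun x => ‖profile u₆ (-x) (-l₆)‖ₑ)
      (measurable_enorm_profile u₁ measurable_id measurable_const)
      (measurable_enorm_profile u₂ measurable_neg measurable_const)
      (measurable_enorm_profile u₃ measurable_id measurable_const)
      (measurable_enorm_profile u₄ measurable_neg measurable_const)
      (measurable_enorm_profile u₅ measurable_id measurable_const)
      (measurable_enorm_profile u₆ measurable_neg measurable_const)
    simp only [hm.lintegral_profile_neg] at h
    rw [mul_assoc 3 K, ENNReal.ofReal_mul (by norm_num : (0 : ℝ) ≤ 3)]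
    have h3 := mul_le_mul_right h (ENNReal.ofReal 3)
    rw [← lintegral_const_mul' _ _ ENNReal.ofReal_ne_top] at h3
    have h33 : ENNReal.ofReal 3 = 3 := by norm_num
    refine le_trans (le_of_eq ?_) (h3.trans (le_of_eq ?_))
    · rw [h33]
      refine lintegral_congr fun w => ?_
      ring
    · simp only [profileMass]
      ring

end fourier

/-- Almost conservation law: the 6-linear expression controlling the time increment of
the second modified mass `E_I⁴` is bounded by `C N^{-3} ∏_{j=1}^{6} ‖Iu_j‖_{X^{0,b}}`.
Here `w = (ξ₁,ξ₂,ξ₃,ξ₄,ξ₅)`, `ξ₆ = -ξ₁-ξ₂-ξ₃-ξ₄-ξ₅` (so that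
`ξ₄+ξ₅+ξ₆ = -ξ₁-ξ₂-ξ₃` and `-ξ₆ = ξ₁+ξ₂+ξ₃+ξ₄+ξ₅`), and
`ŵ_j(t,ξ) = conj(û_j(t,-ξ))`. -/
theorem stmt_14 (b C₀ : ℝ) (hb : 1/2 < b) (hC₀ : 0 < C₀) :
    ∃ C > (0:ℝ), ∀ N : ℝ, 1 ≤ N → ∀ m : ℝ → ℝ, IsIMultiplier N C₀ m →
      ∀ δ : ℝ, 0 < δ → δ ≤ 1 →
      ∀ u₁ u₂ u₃ u₄ u₅ u₆ : SchwartzMap (ℝ × ℝ) ℂ,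
        ENNReal.ofReal
          ‖∫ t in Set.Icc (0:ℝ) δ, ∫ w : ℝ × ℝ × ℝ × ℝ × ℝ,
              (sigma4 m w.1 w.2.1 w.2.2.1 (-w.1 - w.2.1 - w.2.2.1) : ℂ) *
                fourierIntX (fun p => u₁ p) t w.1 *
                (starRingEnd ℂ) (fourierIntX (fun p => u₂ p) t (-w.2.1)) *
                fourierIntX (fun p => u₃ p) t w.2.2.1 *
                (starRingEnd ℂ) (fourierIntX (fun p => u₄ p) t (-w.2.2.2.1)) *
                fourierIntX (fun p => u₅ p) t w.2.2.2.2 *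
                (starRingEnd ℂ) (fourierIntX (fun p => u₆ p) t
                  (w.1 + w.2.1 + w.2.2.1 + w.2.2.2.1 + w.2.2.2.2))‖ ≤
          ENNReal.ofReal (C * N ^ (-(3:ℝ))) *
            (Xnorm 0 b (IopST m (fun p => u₁ p)) * Xnorm 0 b (IopST m (fun p => u₂ p)) *
             Xnorm 0 b (IopST m (fun p => u₃ p)) * Xnorm 0 b (IopST m (fun p => u₄ p)) *
             Xnorm 0 b (IopST m (fun p => u₅ p)) * Xnorm 0 b (IopST m (fun p => u₆ p))) := by
  obtain ⟨K, hK, hform⟩ := exists_lintegral_sigma4_smear_le hC₀.le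
  obtain ⟨B, hB, hmass⟩ := exists_lintegral_profileMass_le hb
  refine ⟨K * B ^ 6, by positivity, fun N hN m hm δ hδ hδ1 u₁ u₂ u₃ u₄ u₅ u₆ => ?_⟩
  rw [integral_integral_swap (hm.integrable_six_form hN hC₀.le δ u₁ u₂ u₃ u₄ u₅ u₆), ofReal_norm]
  have hpos : 0 ≤ K * N ^ (-(3:ℝ)) := mul_nonneg hK.le (Real.rpow_nonneg (by linarith) _)
  calc _ ≤ ∫⁻ w : ℝ × ℝ × ℝ × ℝ × ℝ, _ := enorm_integral_le_lintegral_enorm _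
    _ ≤ _ := lintegral_mono fun w => ?_
    _ ≤ _ := hform N hN m hm u₁ u₂ u₃ u₄ u₅ u₆
    _ ≤ ENNReal.ofReal (K * N ^ (-(3 : ℝ))) *
      ((ENNReal.ofReal B * Xnorm 0 b (IopST m fun p => u₁ p)) *
      ((ENNReal.ofReal B * Xnorm 0 b (IopST m fun p => u₂ p)) *
      ((ENNReal.ofReal B * Xnorm 0 b (IopST m fun p => u₃ p)) *
      ((ENNReal.ofReal B * Xnorm 0 b (IopST m fun p => u₄ p)) *
      ((ENNReal.ofReal B * Xnorm 0 b (IopST m fun p => u₅ p)) *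
      ((ENNReal.ofReal B * Xnorm 0 b (IopST m fun p => u₆ p)) * 1)))))) := by
        gcongr <;> exact hmass N C₀ hN m hm _
    _ = _ := by
        rw [mul_right_comm K, ENNReal.ofReal_mul hpos, ENNReal.ofReal_pow hB.le]
        ring
  have h := enorm_time_integral_le hδ hδ1 u₁ u₂ u₃ u₄ u₅ u₆
    (sigma4 m w.1 w.2.1 w.2.2.1 (-w.1 - w.2.1 - w.2.2.1) : ℂ) w.1 w.2.1 w.2.2.1 w.2.2.2.1 w.2.2.2.2
    (-(w.1 + w.2.1 + w.2.2.1 + w.2.2.2.1 + w.2.2.2.2))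
  rw [← ofReal_norm (sigma4 m w.1 w.2.1 w.2.2.1 (-w.1 - w.2.1 - w.2.2.1) : ℂ), Complex.norm_real,
    Real.norm_eq_abs] at h
  refine le_trans (le_of_eq ?_) h
  simp only [neg_neg]
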